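/- arXiv:math/0404376 — 4 statements merged into one kernel-verified Lean document; each statement's English description precedes it below -/
import Mathlib

section
/- Let B be a unital C*-algebra and z ∈ B with ‖z‖ ≤ 1. Define ρ : B → M₂(B) by ρ(x) = [[x·z, x·√(1 - z·z*)], [0, 0]], where √(1 - z·z*) is the continuous functional calculus square root of the positive element 1 - z·z*. Then for all x, y ∈ B one has ρ(x)·ρ(y) = ρ(x·z·y), and ‖ρ(x)‖ = ‖x‖ for all x ∈ B. In other words, ρ is an isometric homomorphism from B equipped with the product (x, y) ↦ x·z·y into the C*-algebra M₂(B). -/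
open scoped Matrix

/-- The unique C*-algebra norm on `n × n` matrices over a (unital) C*-algebra `B`,
given by the purely algebraic-analytic formula `‖M‖ = √(spectralRadius (Mᴴ * M))`,
which is the unique C*-norm since `Mₙ(B)` is a C*-algebra and in any C*-algebra
`‖a‖² = ‖a⋆a‖ = r(a⋆a)`. -/
noncomputable def cstarMatrixNorm {B : Type*} [Ring B] [StarRing B] [Algebra ℂ B]
    {n : ℕ} (M : Matrix (Fin n) (Fin n) B) : ℝ :=
  Real.sqrt ((spectralRadius ℂ (star M * M)).toReal)

lemma cstarMatrixNorm_eq_norm_ofMatrix {B : Type*} [CStarAlgebra B] [PartialOrder B]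
    [StarOrderedRing B] {n : ℕ} (M : Matrix (Fin n) (Fin n) B) :
    cstarMatrixNorm M = ‖CStarMatrix.ofMatrix M‖ := by
  have h : spectralRadius ℂ (star M * M) =
      ‖star (CStarMatrix.ofMatrix M) * CStarMatrix.ofMatrix M‖₊ :=
    (IsSelfAdjoint.star_mul_self (CStarMatrix.ofMatrix M)).spectralRadius_eq_nnnorm
  rw [cstarMatrixNorm, h, ENNReal.coe_toReal, coe_nnnorm, CStarRing.norm_star_mul_self,
    Real.sqrt_mul_self (norm_nonneg _)]

/-- The upper left corner embedding of `B` into the `2 × 2` matrices over `B`. -/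
def cornerStarAlgHom (B : Type*) [CStarAlgebra B] :
    B →⋆ₙₐ[ℂ] CStarMatrix (Fin 2) (Fin 2) B where
  toFun b := CStarMatrix.ofMatrix !![b, 0; 0, 0]
  map_smul' c b := by
    ext i j
    fin_cases i <;> fin_cases j <;> simp
  map_zero' := by
    ext i j
    fin_cases i <;> fin_cases j <;> simp
  map_add' a b := by
    ext i j
    fin_cases i <;> fin_cases j <;> simp
  map_mul' a b := by
    ext i j
    fin_cases i <;> fin_cases j <;> simp [CStarMatrix.mul_apply]
  map_star' b := by
    ext i j
    fin_cases i <;> fin_cases j <;> simp [CStarMatrix.star_apply]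

lemma norm_cornerStarAlgHom {B : Type*} [CStarAlgebra B] [PartialOrder B] [StarOrderedRing B]
    (b : B) : ‖cornerStarAlgHom B b‖ = ‖b‖ :=
  NonUnitalStarAlgHom.norm_map (cornerStarAlgHom B)
    (fun _ _ h ↦ congrArg (fun M : CStarMatrix (Fin 2) (Fin 2) B ↦ M 0 0) h) b

lemma ofMatrix_row_mul_star {B : Type*} [CStarAlgebra B] (x z s : B)
    (h : z * star z + s * star s = 1) :
    CStarMatrix.ofMatrix !![x * z, x * s; 0, 0] *
      star (CStarMatrix.ofMatrix !![x * z, x * s; 0, 0]) = cornerStarAlgHom B (x * star x) := by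
  have hx : x * z * (star z * star x) + x * s * (star s * star x) = x * star x := by
    calc _ = x * (z * star z + s * star s) * star x := by noncomm_ring
      _ = _ := by rw [h, mul_one]
  ext i j
  fin_cases i <;> fin_cases j <;>
    simp [CStarMatrix.mul_apply, CStarMatrix.star_apply, cornerStarAlgHom, hx]

lemma sqrt_one_sub_mul_star_mul_star {B : Type*} [CStarAlgebra B] [PartialOrder B]
    [StarOrderedRing B] {z : B} (hz : ‖z‖ ≤ 1) :
    CFC.sqrt (1 - z * star z) * star (CFC.sqrt (1 - z * star z)) = 1 - z * star z := by
  have hpos : 0 ≤ 1 - z * star z := by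
    rw [sub_nonneg, ← CStarAlgebra.norm_le_one_iff_of_nonneg _ (mul_star_self_nonneg z),
      CStarRing.norm_self_mul_star]
    exact mul_le_one₀ hz (norm_nonneg z) hz
  rw [(CFC.sqrt_nonneg (1 - z * star z)).isSelfAdjoint.star_eq, CFC.sqrt_mul_sqrt_self _ hpos]

/-- Let `B` be a unital C*-algebra and `z ∈ B` with `‖z‖ ≤ 1`.  Define
`ρ : B → M₂(B)` by `ρ(x) = [[x·z, x·√(1 - z·z*)], [0, 0]]` where the square root is
taken via the continuous functional calculus.  Then `ρ(x)·ρ(y) = ρ(x·z·y)` for all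
`x, y ∈ B`, and `‖ρ(x)‖ = ‖x‖` for all `x ∈ B`. -/
theorem stmt0 {B : Type*} [CStarAlgebra B] [PartialOrder B] [StarOrderedRing B]
    (z : B) (hz : ‖z‖ ≤ 1)
    (ρ : B → Matrix (Fin 2) (Fin 2) B)
    (hρ : ∀ x : B, ρ x = !![x * z, x * CFC.sqrt (1 - z * star z); 0, 0]) :
    (∀ x y : B, ρ x * ρ y = ρ (x * z * y)) ∧
    (∀ x : B, cstarMatrixNorm (ρ x) = ‖x‖) := by
  refine ⟨fun x y ↦ ?_, fun x ↦ ?_⟩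
  · ext i j
    fin_cases i <;> fin_cases j <;> simp [hρ, mul_assoc]
  · rw [cstarMatrixNorm_eq_norm_ofMatrix, hρ,
      ← mul_self_inj (norm_nonneg _) (norm_nonneg _), ← CStarRing.norm_self_mul_star,
      ofMatrix_row_mul_star, norm_cornerStarAlgHom, CStarRing.norm_self_mul_star]
    rw [sqrt_one_sub_mul_star_mul_star hz, add_sub_cancel]
end

section
/- Let B be a unital C*-algebra and z ∈ B with ‖z‖ ≤ 1, and let ρ : B → M₂(B) be defined by ρ(x) = [[x·z, x·√(1 - z·z*)], [0, 0]], where √(1 - z·z*) is the continuous functional calculus square root of the positive element 1 - z·z*. Then ρ is a complete isometry: for every n ∈ ℕ and every matrix (x_{ij}) ∈ Mₙ(B), the matrix (ρ(x_{ij}))_{ij} ∈ Mₙ(M₂(B)) satisfies ‖(ρ(x_{ij}))_{ij}‖ = ‖(x_{ij})‖. -/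
/-- Passing to a corner does not change the spectral radius: `j` embeds `A` as a corner of `A'`
and `k` is the compression onto that corner. -/
theorem spectralRadius_corner {A A' : Type*} [Ring A] [Algebra ℂ A] [Ring A'] [Algebra ℂ A']
    (j : A →ₙₐ[ℂ] A') (k : A' →ₗ[ℂ] A) (hk : k 1 = 1)
    (hl : ∀ a w, k (j a * w) = a * k w) (hr : ∀ a w, k (w * j a) = k w * a) (a : A) :
    spectralRadius ℂ (j a) = spectralRadius ℂ a := by
  have key : ∀ c : ℂ, c ≠ 0 → (c ∈ spectrum ℂ (j a) ↔ c ∈ spectrum ℂ a) := by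
    intro c hc
    rw [spectrum.mem_iff, spectrum.mem_iff, not_iff_not, Algebra.algebraMap_eq_smul_one,
      Algebra.algebraMap_eq_smul_one]
    constructor
    · rw [isUnit_iff_exists, isUnit_iff_exists]
      rintro ⟨w, h₁, h₂⟩
      refine ⟨k w, ?_, ?_⟩
      · simpa [sub_mul, hl, hk] using congrArg k h₁
      · simpa [mul_sub, hr, hk] using congrArg k h₂
    · rw [isUnit_iff_exists, isUnit_iff_exists]
      rintro ⟨w, h₁, h₂⟩
      refine ⟨j w + c⁻¹ • (1 - j 1), ?_, ?_⟩
      · have h := congrArg j h₁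
        simp only [sub_mul, smul_mul_assoc, one_mul, map_sub, map_smul, map_mul] at h
        have e : (c • 1 - j a) * (1 - j 1) = c • (1 - j 1) := by
          rw [sub_mul, mul_sub (j a), ← map_mul]
          simp
        rw [mul_add, mul_smul_comm, e, inv_smul_smul₀ hc, sub_mul, smul_mul_assoc, one_mul, h,
          add_sub_cancel]
      · have h := congrArg j h₂
        simp only [mul_sub, mul_smul_comm, mul_one, map_sub, map_smul, map_mul] at h
        have e : (1 - j 1) * (c • 1 - j a) = c • (1 - j 1) := by
          rw [mul_sub, sub_mul _ _ (j a), ← map_mul]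
          simp
        rw [add_mul, smul_mul_assoc, e, inv_smul_smul₀ hc, mul_sub, mul_smul_comm, mul_one, h,
          add_sub_cancel]
  unfold spectralRadius
  refine iSup_congr fun c => ?_
  rcases eq_or_ne c 0 with rfl | hc
  · simp
  · simp [key c hc]

theorem spectralRadius_mul_comm {A : Type*} [Ring A] [Algebra ℂ A] (a b : A) :
    spectralRadius ℂ (a * b) = spectralRadius ℂ (b * a) := by
  unfold spectralRadius
  refine iSup_congr fun c => ?_
  rcases eq_or_ne c 0 with rfl | hc
  · simp
  · have h : c ∈ spectrum ℂ (a * b) \ {0} ↔ c ∈ spectrum ℂ (b * a) \ {0} := by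
      rw [spectrum.nonzero_mul_comm]
    simp only [Set.mem_sdiff, Set.mem_singleton_iff, hc, not_false_eq_true, and_true] at h
    simp [h]

/-- The embedding of `Mₙ(B)` into `Mₙ(M₂(B))` as the entrywise upper left corner. -/
def cornerEmbedding (B : Type*) [Ring B] [Algebra ℂ B] (n : ℕ) :
    Matrix (Fin n) (Fin n) B →ₙₐ[ℂ] Matrix (Fin n) (Fin n) (Matrix (Fin 2) (Fin 2) B) where
  toFun M := M.map fun b => !![b, 0; 0, 0]
  map_smul' c M := by
    ext p q r s
    fin_cases r <;> fin_cases s <;> simp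
  map_zero' := by
    ext p q r s
    fin_cases r <;> fin_cases s <;> simp
  map_add' M N := by
    ext p q r s
    fin_cases r <;> fin_cases s <;> simp
  map_mul' M N := by
    ext p q r s
    fin_cases r <;> fin_cases s <;> simp [Matrix.mul_apply, Matrix.sum_apply]

@[simp]
theorem cornerEmbedding_apply {B : Type*} [Ring B] [Algebra ℂ B] {n : ℕ}
    (M : Matrix (Fin n) (Fin n) B) (p q : Fin n) :
    cornerEmbedding B n M p q = !![M p q, 0; 0, 0] :=
  rfl

/-- The entrywise compression of `Mₙ(M₂(B))` onto the upper left corner. -/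
def cornerCompression (B : Type*) [Ring B] [Algebra ℂ B] (n : ℕ) :
    Matrix (Fin n) (Fin n) (Matrix (Fin 2) (Fin 2) B) →ₗ[ℂ] Matrix (Fin n) (Fin n) B where
  toFun M := M.map fun b => b 0 0
  map_add' _ _ := rfl
  map_smul' _ _ := rfl

@[simp]
theorem cornerCompression_apply {B : Type*} [Ring B] [Algebra ℂ B] {n : ℕ}
    (M : Matrix (Fin n) (Fin n) (Matrix (Fin 2) (Fin 2) B)) (p q : Fin n) :
    cornerCompression B n M p q = M p q 0 0 :=
  rfl

theorem spectralRadius_cornerEmbedding {B : Type*} [Ring B] [Algebra ℂ B] {n : ℕ}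
    (M : Matrix (Fin n) (Fin n) B) :
    spectralRadius ℂ (cornerEmbedding B n M) = spectralRadius ℂ M := by
  refine spectralRadius_corner (cornerEmbedding B n) (cornerCompression B n) ?_ ?_ ?_ M
  · ext p q
    by_cases h : p = q <;> simp [Matrix.one_apply, h]
  · intro a w
    ext p q
    simp [Matrix.mul_apply, Matrix.sum_apply, Matrix.vecMul, dotProduct]
  · intro a w
    ext p q
    simp [Matrix.mul_apply, Matrix.sum_apply]

theorem mul_star_self_le_one {B : Type*} [CStarAlgebra B] [PartialOrder B] [StarOrderedRing B]
    {z : B} (hz : ‖z‖ ≤ 1) : z * star z ≤ 1 := by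
  refine (CStarAlgebra.norm_le_one_iff_of_nonneg _ (mul_star_self_nonneg z)).mp ?_
  rw [CStarRing.norm_self_mul_star]
  exact mul_le_one₀ hz (norm_nonneg z) hz


open scoped Matrix

/-- Let `B` be a unital C*-algebra, `z ∈ B` with `‖z‖ ≤ 1`, and let
`ρ : B → M₂(B)` be given by `ρ(x) = [[x·z, x·√(1 - z·z*)], [0, 0]]` where the square
root is taken via the continuous functional calculus.  Then `ρ` is a complete
isometry: for every `n` and every `(x_{ij}) ∈ Mₙ(B)`, the norm of
`(ρ(x_{ij}))_{ij}` in `Mₙ(M₂(B))` equals the norm of `(x_{ij})` in `Mₙ(B)`. -/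
theorem stmt1 {B : Type*} [CStarAlgebra B] [PartialOrder B] [StarOrderedRing B]
    (z : B) (hz : ‖z‖ ≤ 1)
    (ρ : B → Matrix (Fin 2) (Fin 2) B)
    (hρ : ∀ x : B, ρ x = !![x * z, x * CFC.sqrt (1 - z * star z); 0, 0]) :
    ∀ (n : ℕ) (x : Matrix (Fin n) (Fin n) B),
      cstarMatrixNorm (x.map ρ) = cstarMatrixNorm x := by
  intro n x
  set s := CFC.sqrt (1 - z * star z)
  have hss : s * s = 1 - z * star z :=
    CFC.sqrt_mul_sqrt_self _ (sub_nonneg.mpr (mul_star_self_le_one hz))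
  have hs : star s = s := (CFC.sqrt_nonneg (1 - z * star z)).isSelfAdjoint.star_eq
  have hρρ (a b : B) : ρ a * star (ρ b) = !![a * star b, 0; 0, 0] := by
    have h : a * z * (star z * star b) + a * s * (s * star b) = a * star b := by
      calc _ = a * (z * star z + s * s) * star b := by noncomm_ring
        _ = a * star b := by rw [hss, add_sub_cancel, mul_one]
    rw [hρ, hρ]
    ext p q
    fin_cases p <;> fin_cases q <;> simp [Matrix.mul_apply, hs, h]
  have hcorner : x.map ρ * star (x.map ρ) = cornerEmbedding B n (x * star x) := by
    ext p q r t
    simp only [Matrix.mul_apply, Matrix.map_apply, Matrix.star_apply, hρρ, cornerEmbedding_apply,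
      Matrix.sum_apply]
    fin_cases r <;> fin_cases t <;> simp
  unfold cstarMatrixNorm
  rw [spectralRadius_mul_comm, hcorner, spectralRadius_cornerEmbedding, spectralRadius_mul_comm]
end

section
/- Let H be a complex Hilbert space, X a nonzero closed linear subspace of the algebra B(H) of bounded operators on H, and φ : X × X → X a bilinear map that is completely contractive in the Christensen–Sinclair sense: for every n ∈ ℕ and all n×n matrices a = (a_{ij}) and b = (b_{ij}) with entries in X, the matrix (∑_k φ(a_{ik}, b_{kj}))_{ij} satisfies ‖(∑_k φ(a_{ik}, b_{kj}))_{ij}‖ ≤ ‖a‖·‖b‖, all norms computed in the C*-algebra Mₙ(B(H)). Suppose there exist nets (e_α) and (f_β) in X with ‖e_α‖ ≤ 1 and ‖f_β‖ ≤ 1 for all indices, such that φ(x, e_α) → x and φ(f_β, x) → x in norm for every x ∈ X. Then there exist a complex Hilbert space K and a linear map π : X → B(K) such that π(φ(x, y)) = π(x)·π(y) for all x, y ∈ X, and π is a complete isometry: for every n ∈ ℕ and every n×n matrix (x_{ij}) with entries in X, ‖(π(x_{ij}))_{ij}‖ (in Mₙ(B(K))) equals ‖(x_{ij})‖ (in Mₙ(B(H))).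 -/
open scoped Matrix

universe u

section
open TensorProduct

/-- A nonnegative function on a complex vector space which is the square of a Hilbert seminorm. -/
structure IsHilbertQuad {V : Type*} [AddCommGroup V] [Module ℂ V] (Q : V → ℝ) : Prop where
  nonneg : ∀ v, 0 ≤ Q v
  smul : ∀ (c : ℂ) v, Q (c • v) = ‖c‖ ^ 2 * Q v
  parallelogram : ∀ v w, Q (v + w) + Q (v - w) = 2 * (Q v + Q w)
  line : ∀ v w (t : ℝ), Q (v + (t : ℂ) • w) =
    Q v + t * (Q (v + w) - Q v - Q w) + t ^ 2 * Q w

theorem isHilbertQuad_norm_sq {V K : Type*} [AddCommGroup V] [Module ℂ V] [NormedAddCommGroup K]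
    [InnerProductSpace ℂ K] (L : V →ₗ[ℂ] K) : IsHilbertQuad fun v => ‖L v‖ ^ 2 where
  nonneg v := by positivity
  smul c v := by rw [map_smul, norm_smul, mul_pow]
  parallelogram v w := by
    have h := parallelogram_law_with_norm ℂ (L v) (L w)
    simp only [map_add, map_sub]
    nlinarith
  line v w t := by
    simp only [map_add, map_smul, norm_add_sq (𝕜 := ℂ), inner_smul_right, norm_smul, mul_pow]
    simp
    ring

theorem IsHilbertQuad.sqrt_add_le {V : Type*} [AddCommGroup V] [Module ℂ V] {Q : V → ℝ}
    (hQ : IsHilbertQuad Q) (v w : V) : √(Q (v + w)) ≤ √(Q v) + √(Q w) := by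
  have hv := hQ.nonneg v
  have hw := hQ.nonneg w
  have hd : discrim (Q w) (Q (v + w) - Q v - Q w) (Q v) ≤ 0 := by
    refine discrim_le_zero fun t => ?_
    have h1 := hQ.nonneg (v + (t : ℂ) • w)
    rw [hQ.line] at h1
    linarith
  rw [discrim] at hd
  have hle : Q (v + w) - Q v - Q w ≤ 2 * (√(Q v) * √(Q w)) := by
    refine le_of_sq_le_sq ?_ (by positivity)
    rw [mul_pow, mul_pow, Real.sq_sqrt hv, Real.sq_sqrt hw]
    linarith
  apply Real.sqrt_le_iff.2
  refine ⟨by positivity, ?_⟩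
  nlinarith [Real.sq_sqrt hv, Real.sq_sqrt hw]

theorem IsHilbertQuad.exists_linearMap {V : Type u} [AddCommGroup V] [Module ℂ V] {Q : V → ℝ}
    (hQ : IsHilbertQuad Q) :
    ∃ (K : Type u) (_ : NormedAddCommGroup K) (_ : InnerProductSpace ℂ K) (_ : CompleteSpace K)
      (L : V →ₗ[ℂ] K), DenseRange L ∧ ∀ v, ‖L v‖ ^ 2 = Q v := by
  let p : Seminorm ℂ V := Seminorm.of (fun v => √(Q v)) hQ.sqrt_add_le fun c v => by
    rw [hQ.smul, Real.sqrt_mul (by positivity), Real.sqrt_sq (norm_nonneg c)]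
  let : SeminormedAddCommGroup V := p.toSeminormedAddCommGroup
  let : NormedSpace ℂ V := { norm_smul_le := fun c v => (map_smul_eq_mul p c v).le }
  have hn : ∀ v : V, ‖v‖ ^ 2 = Q v := fun v => Real.sq_sqrt (hQ.nonneg v)
  let L : V →ₗ[ℂ] UniformSpace.Completion V :=
    (UniformSpace.Completion.toComplₗᵢ (𝕜 := ℂ)).toLinearMap
  have hpar : ∀ x y : UniformSpace.Completion V,
      ‖x + y‖ * ‖x + y‖ + ‖x - y‖ * ‖x - y‖ = 2 * (‖x‖ * ‖x‖ + ‖y‖ * ‖y‖) := by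
    intro x y
    induction x, y using UniformSpace.Completion.induction_on₂ with
    | hp => exact isClosed_eq (by fun_prop) (by fun_prop)
    | ih v w =>
      simp only [← UniformSpace.Completion.coe_add, ← UniformSpace.Completion.coe_sub,
        UniformSpace.Completion.norm_coe, ← sq, hn]
      exact hQ.parallelogram v w
  refine ⟨UniformSpace.Completion V, inferInstance, InnerProductSpace.ofNorm ℂ hpar, inferInstance,
    L, UniformSpace.Completion.denseRange_coe, fun v => ?_⟩
  exact (congrArg (· ^ 2) (UniformSpace.Completion.norm_coe v)).trans (hn v)

/-- The sum of the squared moduli of a functional over a finite family of vectors. -/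
noncomputable def evalQuad {V ι : Type*} [AddCommGroup V] [Module ℂ V] [Fintype ι] (z : ι → V)
    (f : V →ₗ[ℂ] ℂ) : ℝ := ∑ i, ‖f (z i)‖ ^ 2

/-- The squared modulus of a functional at a vector. -/
noncomputable def evalSq {V : Type*} [AddCommGroup V] [Module ℂ V] (v : V) (f : V →ₗ[ℂ] ℂ) : ℝ :=
    ‖f v‖ ^ 2

theorem evalQuad_eq_sum {V ι : Type*} [AddCommGroup V] [Module ℂ V] [Fintype ι] (z : ι → V) :
    evalQuad z = ∑ i, evalSq (z i) := by
  ext f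
  simp [evalQuad, evalSq, Finset.sum_apply]

/-- A Riesz extension argument: Hilbert quadratic forms exist between compatible systems of lower
bounds `L` and upper bounds `U`. -/
theorem exists_isHilbertQuad_between {V : Type*} [AddCommGroup V] [Module ℂ V]
    (U L : PointedCone ℝ (((V →ₗ[ℂ] ℂ) → ℝ) × ℝ))
    (hU : ∀ v : V, ∃ r, (evalSq v, r) ∈ U) (hL : ∀ v : V, (evalSq v, (0 : ℝ)) ∈ L)
    (hUL : ∀ g r s, (g, r) ∈ U → (g, s) ∈ L → s ≤ r) :
    ∃ Q : V → ℝ, IsHilbertQuad Q ∧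
      (∀ (ι : Type) [Fintype ι] (z : ι → V) (r : ℝ), (evalQuad z, r) ∈ U → ∑ i, Q (z i) ≤ r) ∧
      ∀ (ι : Type) [Fintype ι] (z : ι → V) (s : ℝ), (evalQuad z, s) ∈ L → s ≤ ∑ i, Q (z i) := by
  let F := (V →ₗ[ℂ] ℂ) → ℝ
  let E : Submodule ℝ F := Submodule.span ℝ (Set.range evalSq)
  let C : PointedCone ℝ (E × ℝ) :=
    (U.map ((-LinearMap.id : F →ₗ[ℝ] F).prodMap (LinearMap.id : ℝ →ₗ[ℝ] ℝ)) ⊔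
      L.map ((LinearMap.id : F →ₗ[ℝ] F).prodMap (-LinearMap.id : ℝ →ₗ[ℝ] ℝ))).comap
        (E.subtype.prodMap (LinearMap.id : ℝ →ₗ[ℝ] ℝ))
  have hC : ∀ (g : E) (r : ℝ), (g, r) ∈ C ↔ ∃ u ∈ U, ∃ l ∈ L,
      (-u.1 + l.1 = (g : F)) ∧ u.2 - l.2 = r := by
    intro g r
    simp only [C, PointedCone.mem_comap, Submodule.mem_sup, PointedCone.mem_map]
    constructor
    · rintro ⟨_, ⟨u, hu, rfl⟩, _, ⟨l, hl, rfl⟩, h⟩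
      refine ⟨u, hu, l, hl, ?_, ?_⟩
      · simpa using congrArg Prod.fst h
      · simpa [sub_eq_add_neg] using congrArg Prod.snd h
    · rintro ⟨u, hu, l, hl, h1, h2⟩
      refine ⟨_, ⟨u, hu, rfl⟩, _, ⟨l, hl, rfl⟩, Prod.ext ?_ ?_⟩
      · simpa using h1
      · simpa [sub_eq_add_neg] using h2
  have hE : ∀ g : E, ∃ u ∈ U, ∃ l ∈ L, -u.1 + l.1 = (g : F) := by
    suffices h : ∀ g ∈ E, ∃ a b : F, g = b - a ∧ ((∃ r, (a, r) ∈ U) ∧ ∃ s, (a, s) ∈ L) ∧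
        (∃ r, (b, r) ∈ U) ∧ ∃ s, (b, s) ∈ L by
      rintro ⟨g, hg⟩
      obtain ⟨a, b, rfl, ⟨⟨r, hr⟩, -⟩, -, s, hs⟩ := h g hg
      exact ⟨_, hr, _, hs, by simp; abel⟩
    intro g hg
    have h0 : (∃ r, ((0 : F), r) ∈ U) ∧ ∃ s, ((0 : F), s) ∈ L := ⟨⟨0, U.zero_mem⟩, 0, L.zero_mem⟩
    induction hg using Submodule.span_induction with
    | mem g hg =>
      obtain ⟨v, rfl⟩ := hg
      exact ⟨0, evalSq v, by simp, h0, hU v, 0, hL v⟩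
    | zero => exact ⟨0, 0, by simp, h0, h0⟩
    | add g g' _ _ h h' =>
      obtain ⟨a, b, rfl, ⟨⟨r, hr⟩, s, hs⟩, ⟨r', hr'⟩, s', hs'⟩ := h
      obtain ⟨a', b', rfl, ⟨⟨t, ht⟩, u, hu⟩, ⟨t', ht'⟩, u', hu'⟩ := h'
      exact ⟨a + a', b + b', by abel, ⟨⟨_, U.add_mem hr ht⟩, _, L.add_mem hs hu⟩,
        ⟨_, U.add_mem hr' ht'⟩, _, L.add_mem hs' hu'⟩
    | smul c g _ h =>
      obtain ⟨a, b, rfl, ⟨⟨r, hr⟩, s, hs⟩, ⟨r', hr'⟩, s', hs'⟩ := h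
      rcases le_total 0 c with hc | hc
      · exact ⟨c • a, c • b, by rw [smul_sub], ⟨⟨_, U.smul_mem hc hr⟩, _, L.smul_mem hc hs⟩,
          ⟨_, U.smul_mem hc hr'⟩, _, L.smul_mem hc hs'⟩
      · have hc' : 0 ≤ -c := by linarith
        exact ⟨(-c) • b, (-c) • a, by module,
          ⟨⟨_, U.smul_mem hc' hr'⟩, _, L.smul_mem hc' hs'⟩,
          ⟨_, U.smul_mem hc' hr⟩, _, L.smul_mem hc' hs⟩
  obtain ⟨w, hw, hwC⟩ := riesz_extension C
    ((LinearMap.snd ℝ E ℝ).toPMap (LinearMap.range (LinearMap.inr ℝ E ℝ))) (by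
      rintro ⟨_, r, rfl⟩ h
      obtain ⟨u, hu, l, hl, h1, h2⟩ := (hC _ _).1 h
      have h3 : u.1 = l.1 := by simpa [neg_add_eq_zero] using h1
      have h4 := hUL l.1 u.2 l.2 (h3 ▸ hu) hl
      change 0 ≤ r
      simp at h2
      linarith) (by
      rintro ⟨g, s⟩
      obtain ⟨u, hu, l, hl, h⟩ := hE g
      refine ⟨⟨(0, u.2 - l.2 - s), _, rfl⟩, ?_⟩
      have : ((0 : E), u.2 - l.2 - s) + (g, s) = (g, u.2 - l.2) := by ext1 <;> simp
      exact this ▸ (hC _ _).2 ⟨u, hu, l, hl, h, rfl⟩)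
  have hw0 : ∀ r : ℝ, w (0, r) = r := fun r => hw ⟨(0, r), r, rfl⟩
  let q : V → E := fun v => ⟨evalSq v, Submodule.subset_span ⟨v, rfl⟩⟩
  let ω : E →ₗ[ℝ] ℝ := w ∘ₗ LinearMap.inl ℝ E ℝ
  have hωr : ∀ g r, w (g, r) = ω g + r := fun g r => by
    have : (g, r) = (g, 0) + ((0 : E), r) := by simp
    rw [this, map_add, hw0]; rfl
  have hsum : ∀ (ι : Type) [Fintype ι] (z : ι → V),
      ((∑ i, q (z i) : E) : F) = evalQuad z := fun ι _ z => by
    simp [evalQuad_eq_sum, q]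
  have hlow : ∀ (ι : Type) [Fintype ι] (z : ι → V) (s : ℝ), (evalQuad z, s) ∈ L →
      s ≤ ∑ i, ω (q (z i)) := by
    intro ι _ z s hs
    have h := hwC (∑ i, q (z i), -s) ((hC _ _).2 ⟨0, U.zero_mem, _, hs, by simp [hsum], by simp⟩)
    rw [hωr, map_sum] at h
    linarith
  have hq := fun f : V →ₗ[ℂ] ℂ => isHilbertQuad_norm_sq f
  refine ⟨fun v => ω (q v), ⟨fun v => ?_, fun c v => ?_, fun v w => ?_, fun v w t => ?_⟩, ?_, hlow⟩
  · simpa using hlow Unit (fun _ => v) 0 (by simpa [evalQuad_eq_sum] using hL v)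
  · have : q (c • v) = ‖c‖ ^ 2 • q v := Subtype.ext (funext fun f => (hq f).smul c v)
    simp [this]
  · have : q (v + w) + q (v - w) = (2 : ℝ) • (q v + q w) :=
      Subtype.ext (funext fun f => (hq f).parallelogram v w)
    simpa [mul_add] using congrArg ω this
  · have : q (v + (t : ℂ) • w) = q v + t • (q (v + w) - q v - q w) + t ^ 2 • q w :=
      Subtype.ext (funext fun f => (hq f).line v w t)
    simpa using congrArg ω this
  · intro ι _ z r hr
    have h := hwC (-∑ i, q (z i), r) ((hC _ _).2 ⟨_, hr, 0, L.zero_mem, by simp [hsum], by simp⟩)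
    rw [hωr, map_neg, map_sum] at h
    linarith

/-- Families of vectors with the same evaluation quadratic form differ by a scalar contraction. -/
theorem exists_contraction_of_evalQuad_eq {V ι κ : Type*} [AddCommGroup V] [Module ℂ V]
    [Fintype ι] [Fintype κ] (z : ι → V) (y : κ → V) (h : evalQuad y = evalQuad z) :
    ∃ u : κ → ι → ℂ, (∀ c : ι → ℂ, ∑ k, ‖∑ i, u k i * c i‖ ^ 2 ≤ ∑ i, ‖c i‖ ^ 2) ∧
      ∀ k, y k = ∑ i, u k i • z i := by
  classical
  let Z : (V →ₗ[ℂ] ℂ) →ₗ[ℂ] EuclideanSpace ℂ ι :=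
    { toFun := fun f => WithLp.toLp 2 fun i => f (z i)
      map_add' := fun f g => rfl
      map_smul' := fun c f => rfl }
  let Y : (V →ₗ[ℂ] ℂ) →ₗ[ℂ] EuclideanSpace ℂ κ :=
    { toFun := fun f => WithLp.toLp 2 fun i => f (y i)
      map_add' := fun f g => rfl
      map_smul' := fun c f => rfl }
  have hYZ : ∀ f, ‖Y f‖ = ‖Z f‖ := fun f => by
    rw [EuclideanSpace.norm_eq, EuclideanSpace.norm_eq]
    exact congrArg Real.sqrt (congrFun h f)
  let S := LinearMap.range Z
  obtain ⟨s, hs⟩ := Z.rangeRestrict.exists_rightInverse_of_surjective Z.range_rangeRestrict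
  have hZs : ∀ x : S, Z (s x) = x := fun x => congrArg Subtype.val (LinearMap.congr_fun hs x)
  let A : EuclideanSpace ℂ ι →ₗ[ℂ] EuclideanSpace ℂ κ :=
    Y ∘ₗ s ∘ₗ (S.orthogonalProjectionOnto : EuclideanSpace ℂ ι →ₗ[ℂ] S)
  have hA : ∀ x, ‖A x‖ ≤ ‖x‖ := fun x => by
    change ‖Y (s (S.orthogonalProjectionOnto x))‖ ≤ _
    rw [hYZ, hZs]
    exact S.norm_orthogonalProjectionOnto_apply_le x
  have hAZ : ∀ f, A (Z f) = Y f := fun f => by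
    change Y (s (S.orthogonalProjectionOnto (Z f))) = _
    have h1 : Z (s (S.orthogonalProjectionOnto (Z f)) - f) = 0 := by
      rw [map_sub, hZs, S.orthogonalProjectionOnto_mem_subspace_eq_self (⟨Z f, f, rfl⟩ : S),
        sub_self]
    have h2 := hYZ (s (S.orthogonalProjectionOnto (Z f)) - f)
    rw [h1, norm_zero, norm_eq_zero, map_sub, sub_eq_zero] at h2
    exact h2
  have hAs : ∀ (x : EuclideanSpace ℂ ι) k,
      A x k = ∑ i, A (EuclideanSpace.single i 1) k * x i := fun x k => by
    have hx : x = ∑ i, x i • EuclideanSpace.single i (1 : ℂ) := by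
      ext j; simp [Pi.single_apply]
    conv_lhs => rw [hx, map_sum]
    simp [mul_comm]
  refine ⟨fun k i => A (EuclideanSpace.single i 1) k, fun c => ?_, fun k => ?_⟩
  · have h1 := pow_le_pow_left₀ (norm_nonneg _) (hA (WithLp.toLp 2 c)) 2
    simpa [EuclideanSpace.norm_sq_eq, hAs (WithLp.toLp 2 c)] using h1
  · rw [← sub_eq_zero, ← Module.forall_dual_apply_eq_zero_iff ℂ]
    intro f
    have h1 := congrArg (fun x : EuclideanSpace ℂ κ => x k) (hAZ f)
    rw [hAs] at h1
    rw [map_sub, map_sum, sub_eq_zero]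
    simp only [map_smul, smul_eq_mul]
    exact h1.symm

/-- A finite matrix of operators which acts contractively between Hilbert space direct sums. -/
def OpContr {E F ι κ : Type*} [NormedAddCommGroup E] [InnerProductSpace ℂ E]
    [NormedAddCommGroup F] [InnerProductSpace ℂ F] [Fintype ι] [Fintype κ]
    (v : ι → κ → (E →L[ℂ] F)) : Prop :=
  ∀ ξ : κ → E, ∑ i, ‖∑ j, v i j (ξ j)‖ ^ 2 ≤ ∑ j, ‖ξ j‖ ^ 2

/-- A finite matrix over a space of operators which is a contraction. -/
def MContr {H : Type*} [NormedAddCommGroup H] [InnerProductSpace ℂ H]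
    {X : Submodule ℂ (H →L[ℂ] H)} {ι κ : Type*} [Fintype ι] [Fintype κ]
    (v : Matrix ι κ X) : Prop := OpContr fun i j => (v i j : H →L[ℂ] H)

/-- Squares of Hilbert seminorms on `X ⊗ E` dominated by the Haagerup column norm. -/
structure IsAdm {H E : Type*} [NormedAddCommGroup H] [InnerProductSpace ℂ H]
    [NormedAddCommGroup E] [InnerProductSpace ℂ E]
    {X : Submodule ℂ (H →L[ℂ] H)} (Q : X ⊗[ℂ] E → ℝ) : Prop where
  quad : IsHilbertQuad Q
  bound : ∀ (ι κ : Type) [Fintype ι] [Fintype κ] (v : Matrix ι κ X), MContr v → ∀ ξ : κ → E,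
    ∑ i, Q (∑ j, v i j ⊗ₜ ξ j) ≤ ∑ j, ‖ξ j‖ ^ 2

/-- Left multiplication is contractive on columns, with a spectator block. -/
def LeftContractive {H : Type*} [NormedAddCommGroup H] [InnerProductSpace ℂ H]
    {X : Submodule ℂ (H →L[ℂ] H)} (φ : X →ₗ[ℂ] X →ₗ[ℂ] X) : Prop :=
  ∀ (ι κ ν : Type) [Fintype ι] [Fintype κ] [Fintype ν] (T : Matrix κ κ X)
    (b : Matrix ι ν X) (a : Matrix κ ν X), MContr T → MContr (Matrix.fromRows b a) →
    MContr (Matrix.fromRows b (Matrix.of fun k j => ∑ l, φ (T k l) (a l j)))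

theorem sum_norm_sq_le_of_scalar_contraction {E ι κ : Type*} [NormedAddCommGroup E]
    [InnerProductSpace ℂ E] [Fintype ι] [Fintype κ] {u : κ → ι → ℂ}
    (hu : ∀ c : ι → ℂ, ∑ k, ‖∑ i, u k i * c i‖ ^ 2 ≤ ∑ i, ‖c i‖ ^ 2) (h : ι → E) :
    ∑ k, ‖∑ i, u k i • h i‖ ^ 2 ≤ ∑ i, ‖h i‖ ^ 2 := by
  let S := Submodule.span ℂ (Set.range h)
  have : FiniteDimensional ℂ S := FiniteDimensional.span_of_finite ℂ (Set.finite_range h)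
  let b := stdOrthonormalBasis ℂ S
  let g : ι → S := fun i => ⟨h i, Submodule.subset_span ⟨i, rfl⟩⟩
  have hg : ∀ k, ‖∑ i, u k i • h i‖ = ‖∑ i, u k i • g i‖ := fun k => by
    rw [← Submodule.norm_coe]; simp [g]
  calc ∑ k, ‖∑ i, u k i • h i‖ ^ 2
      = ∑ k, ∑ s, ‖∑ i, u k i * inner ℂ (b s) (g i)‖ ^ 2 := by
        refine Finset.sum_congr rfl fun k _ => ?_
        rw [hg, ← b.sum_sq_norm_inner_right]
        simp [inner_sum, inner_smul_right]
    _ = ∑ s, ∑ k, ‖∑ i, u k i * inner ℂ (b s) (g i)‖ ^ 2 := Finset.sum_comm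
    _ ≤ ∑ s, ∑ i, ‖inner ℂ (b s) (g i)‖ ^ 2 := Finset.sum_le_sum fun s _ => hu _
    _ = ∑ i, ∑ s, ‖inner ℂ (b s) (g i)‖ ^ 2 := Finset.sum_comm
    _ = ∑ i, ‖h i‖ ^ 2 := Finset.sum_congr rfl fun i _ => by
        rw [b.sum_sq_norm_inner_right]; rfl

section
variable {H E : Type u} [NormedAddCommGroup H] [InnerProductSpace ℂ H]
  [NormedAddCommGroup E] [InnerProductSpace ℂ E] {X : Submodule ℂ (H →L[ℂ] H)}

theorem MContr.fromBlocks {ι κ ι' κ' : Type*} [Fintype ι] [Fintype κ] [Fintype ι'] [Fintype κ']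
    {v : Matrix ι κ X} {w : Matrix ι' κ' X} (hv : MContr v) (hw : MContr w) :
    MContr (Matrix.fromBlocks v 0 0 w) := fun ξ => by
  simpa using add_le_add (hv fun j => ξ (.inl j)) (hw fun j => ξ (.inr j))

theorem MContr.scalar_mul {ι κ ν : Type*} [Fintype ι] [Fintype κ] [Fintype ν] {u : κ → ι → ℂ}
    (hu : ∀ c : ι → ℂ, ∑ k, ‖∑ i, u k i * c i‖ ^ 2 ≤ ∑ i, ‖c i‖ ^ 2) {v : Matrix ι ν X}
    (hv : MContr v) : MContr (Matrix.of fun k j => ∑ i, u k i • v i j) := fun ξ => by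
  refine le_trans (le_of_eq ?_) ((sum_norm_sq_le_of_scalar_contraction hu
    fun i => ∑ j, (v i j : H →L[ℂ] H) (ξ j)).trans (hv ξ))
  refine Finset.sum_congr rfl fun k _ => ?_
  congr 2
  simp only [Matrix.of_apply, Submodule.coe_sum, sum_apply, Finset.smul_sum]
  rw [Finset.sum_comm]
  simp

theorem inv_smul_tmul_smul {x : X} {h : E} {c : ℂ} (hc : c ≠ 0) :
    (c⁻¹ • x) ⊗ₜ[ℂ] (c • h) = x ⊗ₜ[ℂ] h := by
  rw [TensorProduct.smul_tmul, smul_smul, inv_mul_cancel₀ hc, one_smul]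

theorem exists_mContr_row (v : X ⊗[ℂ] E) : ∃ (κ : Type) (_ : Fintype κ) (w : Matrix Unit κ X)
    (ξ : κ → E), MContr w ∧ v = ∑ j, w () j ⊗ₜ ξ j := by
  induction v using TensorProduct.induction_on with
  | zero => exact ⟨Empty, inferInstance, fun _ => Empty.elim, Empty.elim, fun ξ => by simp, by simp⟩
  | tmul x h =>
    have hc : (0 : ℝ) < ‖x‖ + 1 := by positivity
    refine ⟨Unit, inferInstance, fun _ _ => ((‖x‖ + 1 : ℝ) : ℂ)⁻¹ • x,
      fun _ => ((‖x‖ + 1 : ℝ) : ℂ) • h, fun ξ => ?_, ?_⟩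
    · simp only [Finset.univ_unique, Finset.sum_singleton]
      refine pow_le_pow_left₀ (norm_nonneg _) ?_ 2
      refine (ContinuousLinearMap.le_of_opNorm_le _ (c := 1) ?_ _).trans_eq (one_mul _)
      rw [Submodule.coe_smul, norm_smul, norm_inv, Complex.norm_real, Real.norm_of_nonneg hc.le,
        inv_mul_le_iff₀ hc]
      change ‖x‖ ≤ _
      linarith
    · have : ((‖x‖ + 1 : ℝ) : ℂ) ≠ 0 := by exact_mod_cast hc.ne'
      simp only [Finset.univ_unique, Finset.sum_singleton]
      exact (inv_smul_tmul_smul this).symm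
  | add v v' h h' =>
    obtain ⟨κ, _, w, ξ, hw, rfl⟩ := h
    obtain ⟨κ', _, w', ξ', hw', rfl⟩ := h'
    have h2 : ((√2 : ℝ) : ℂ) ≠ 0 := by simp
    refine ⟨κ ⊕ κ', inferInstance,
      Matrix.of fun _ j => ((√2 : ℝ) : ℂ)⁻¹ • Sum.elim (w ()) (w' ()) j,
      fun j => ((√2 : ℝ) : ℂ) • Sum.elim ξ ξ' j, fun η => ?_, ?_⟩
    · have h1 := hw fun j => η (.inl j)
      have h1' := hw' fun j => η (.inr j)
      simp only [Finset.univ_unique, Finset.sum_singleton] at h1 h1'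
      simp only [Finset.univ_unique, Finset.sum_singleton, Fintype.sum_sum_type, Matrix.of_apply,
        Sum.elim_inl, Sum.elim_inr, Submodule.coe_smul, smul_apply,
        ← Finset.smul_sum, norm_smul, mul_pow, norm_inv, Complex.norm_real]
      rw [Real.norm_of_nonneg (Real.sqrt_nonneg 2), inv_pow, Real.sq_sqrt zero_le_two]
      set A := ∑ j, (w () j : H →L[ℂ] H) (η (.inl j))
      set B := ∑ j, (w' () j : H →L[ℂ] H) (η (.inr j))
      have hp := parallelogram_law_with_norm ℂ A B
      have h1'' : ‖A‖ ^ 2 ≤ ∑ j, ‖η (.inl j)‖ ^ 2 := h1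
      have h1''' : ‖B‖ ^ 2 ≤ ∑ j, ‖η (.inr j)‖ ^ 2 := h1'
      nlinarith [mul_self_nonneg ‖A - B‖]
    · simp only [Fintype.sum_sum_type, Matrix.of_apply, Sum.elim_inl, Sum.elim_inr,
        inv_smul_tmul_smul h2]

theorem IsAdm.exists_dominating {φ : X →ₗ[ℂ] X →ₗ[ℂ] X} (hφ : LeftContractive φ)
    {Q : X ⊗[ℂ] E → ℝ} (hQ : IsAdm Q) :
    ∃ Q' : X ⊗[ℂ] E → ℝ, IsAdm Q' ∧ Q ≤ Q' ∧
      ∀ (κ : Type) [Fintype κ] (T : Matrix κ κ X), MContr T → ∀ a : κ → X ⊗[ℂ] E,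
        ∑ k, Q (∑ l, (φ (T k l)).rTensor E (a l)) ≤ ∑ k, Q' (a k) := by
  let U : PointedCone ℝ ((((X ⊗[ℂ] E) →ₗ[ℂ] ℂ) → ℝ) × ℝ) :=
    { carrier := {x | ∃ (ι κ : Type) (_ : Fintype ι) (_ : Fintype κ) (v : Matrix ι κ X) (ξ : κ → E),
        MContr v ∧ ∑ j, ‖ξ j‖ ^ 2 ≤ x.2 ∧ x.1 = evalQuad fun i => ∑ j, v i j ⊗ₜ[ℂ] ξ j}
      zero_mem' := ⟨Empty, Empty, inferInstance, inferInstance, 0, Empty.elim, fun ξ => by simp,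
        by simp, by ext; simp [evalQuad]⟩
      add_mem' := by
        rintro ⟨g, r⟩ ⟨g', r'⟩ ⟨ι, κ, _, _, v, ξ, hv, hr, hg⟩ ⟨ι', κ', _, _, v', ξ', hv', hr', hg'⟩
        refine ⟨ι ⊕ ι', κ ⊕ κ', inferInstance, inferInstance, Matrix.fromBlocks v 0 0 v',
          Sum.elim ξ ξ', hv.fromBlocks hv', by simpa using add_le_add hr hr', ?_⟩
        simp only at hg hg'
        ext f
        simp [hg, hg', evalQuad]
      smul_mem' := by
        rintro ⟨c, hc⟩ ⟨g, r⟩ ⟨ι, κ, _, _, v, ξ, hv, hr, hg⟩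
        simp only at hg hr
        have h1 : ‖((√c : ℝ) : ℂ)‖ ^ 2 = c := by
          rw [Complex.norm_real, Real.norm_of_nonneg (Real.sqrt_nonneg c), Real.sq_sqrt hc]
        refine ⟨ι, κ, inferInstance, inferInstance, v, fun j => ((√c : ℝ) : ℂ) • ξ j, hv, ?_, ?_⟩
        · simp only [norm_smul, mul_pow, h1, ← Finset.mul_sum]
          exact mul_le_mul_of_nonneg_left hr hc
        · ext f
          simp only [evalQuad, TensorProduct.tmul_smul, ← Finset.smul_sum, map_smul, norm_smul,
            mul_pow, h1, ← Finset.mul_sum, hg]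
          rfl }
  let L : PointedCone ℝ ((((X ⊗[ℂ] E) →ₗ[ℂ] ℂ) → ℝ) × ℝ) :=
    { carrier := {x | ∃ (ι κ : Type) (_ : Fintype ι) (_ : Fintype κ) (T : Matrix κ κ X)
        (b : ι → X ⊗[ℂ] E) (a : κ → X ⊗[ℂ] E), MContr T ∧
        x.2 ≤ ∑ i, Q (b i) + ∑ k, Q (∑ l, (φ (T k l)).rTensor E (a l)) ∧
        x.1 = evalQuad b + evalQuad a}
      zero_mem' := ⟨Empty, Empty, inferInstance, inferInstance, 0, Empty.elim, Empty.elim,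
        fun ξ => by simp, by simp, by ext; simp [evalQuad]⟩
      add_mem' := by
        rintro ⟨g, r⟩ ⟨g', r'⟩ ⟨ι, κ, _, _, T, b, a, hT, hr, hg⟩ ⟨ι', κ', _, _, T', b', a', hT',
            hr', hg'⟩
        simp only at hg hg' hr hr'
        refine ⟨ι ⊕ ι', κ ⊕ κ', inferInstance, inferInstance, Matrix.fromBlocks T 0 0 T',
          Sum.elim b b', Sum.elim a a', hT.fromBlocks hT', ?_, ?_⟩
        · simp only [Fintype.sum_sum_type, Sum.elim_inl, Sum.elim_inr, Matrix.fromBlocks_apply₁₁,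
            Matrix.fromBlocks_apply₁₂, Matrix.fromBlocks_apply₂₁, Matrix.fromBlocks_apply₂₂,
            Matrix.zero_apply, map_zero, LinearMap.rTensor_zero, LinearMap.zero_apply,
            Finset.sum_const_zero, add_zero, zero_add, Prod.mk_add_mk]
          linarith
        · ext f
          simp [hg, hg', evalQuad]
          ring
      smul_mem' := by
        rintro ⟨c, hc⟩ ⟨g, r⟩ ⟨ι, κ, _, _, T, b, a, hT, hr, hg⟩
        simp only at hg hr
        have h1 : ‖((√c : ℝ) : ℂ)‖ ^ 2 = c := by
          rw [Complex.norm_real, Real.norm_of_nonneg (Real.sqrt_nonneg c), Real.sq_sqrt hc]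
        refine ⟨ι, κ, inferInstance, inferInstance, T, fun i => ((√c : ℝ) : ℂ) • b i,
          fun j => ((√c : ℝ) : ℂ) • a j, hT, ?_, ?_⟩
        · simp only [map_smul, ← Finset.smul_sum, hQ.quad.smul, h1, ← Finset.mul_sum, ← mul_add]
          exact mul_le_mul_of_nonneg_left hr hc
        · ext f
          simp only [evalQuad, map_smul, norm_smul, mul_pow, h1, ← Finset.mul_sum, hg, Pi.add_apply,
            ← mul_add]
          rfl }
  have hU : ∀ v : X ⊗[ℂ] E, ∃ r, (evalSq v, r) ∈ U := fun v => by
      obtain ⟨κ, _, w, ξ, hw, rfl⟩ := exists_mContr_row v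
      exact ⟨_, Unit, κ, inferInstance, inferInstance, w, ξ, hw, le_rfl, by
        simp [evalQuad_eq_sum]⟩
  have hL : ∀ v : X ⊗[ℂ] E, (evalSq v, (0 : ℝ)) ∈ L :=
    fun v => ⟨Unit, Empty, inferInstance, inferInstance, 0, fun _ => v, Empty.elim,
      fun ξ => by simp, by simpa using hQ.quad.nonneg v, by simp [evalQuad_eq_sum]⟩
  have hUL : ∀ g r s, (g, r) ∈ U → (g, s) ∈ L → s ≤ r := by
      rintro _ r s ⟨ν, μ, _, _, v, ξ, hv, hr, rfl⟩ ⟨ι, κ, _, _, T, b, a, hT, hs, hg⟩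
      simp only at hr hs hg
      have hba : evalQuad (Sum.elim b a) = evalQuad fun i => ∑ j, v i j ⊗ₜ[ℂ] ξ j := by
        rw [hg]; ext f; simp [evalQuad]
      obtain ⟨c, hc, hcv⟩ := exists_contraction_of_evalQuad_eq _ _ hba
      have hw := hv.scalar_mul hc
      have hcv' : ∀ k, Sum.elim b a k = ∑ j, (∑ i, c k i • v i j) ⊗ₜ[ℂ] ξ j := fun k => by
        simp only [hcv, Finset.smul_sum, TensorProduct.sum_tmul, TensorProduct.smul_tmul']
        rw [Finset.sum_comm]
      let w := Matrix.of fun k j => ∑ i, c k i • v i j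
      have hw' := hφ ι κ μ T w.toRows₁ w.toRows₂ hT (by rwa [Matrix.fromRows_toRows])
      have h := hQ.bound _ _ _ hw' ξ
      simp only [Fintype.sum_sum_type, Matrix.fromRows_apply_inl, Matrix.fromRows_apply_inr] at h
      refine (hs.trans (le_of_eq ?_)).trans (h.trans hr)
      congr 1
      · exact Finset.sum_congr rfl fun i _ => congrArg Q (hcv' (.inl i))
      · refine Finset.sum_congr rfl fun k _ => congrArg Q ?_
        have ha : ∀ l, a l = ∑ j, w.toRows₂ l j ⊗ₜ[ℂ] ξ j := fun l => hcv' (.inr l)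
        simp only [ha, map_sum, LinearMap.rTensor_tmul, Matrix.of_apply, TensorProduct.sum_tmul]
        rw [Finset.sum_comm]
  obtain ⟨Q', hQ', hup, hlow⟩ := exists_isHilbertQuad_between (V := X ⊗[ℂ] E) U L hU hL hUL
  refine ⟨Q', ⟨hQ', fun ι κ _ _ v hv ξ => ?_⟩, fun v => ?_, fun κ _ T hT a => ?_⟩
  · exact hup ι _ _ ⟨ι, κ, inferInstance, inferInstance, v, ξ, hv, le_rfl, rfl⟩
  · simpa using hlow Unit (fun _ => v) (Q v) ⟨Unit, Empty, inferInstance, inferInstance, 0,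
      fun _ => v, Empty.elim, fun ξ => by simp, by simp, by simp [evalQuad_eq_sum]⟩
  · exact hlow κ a _ ⟨Empty, κ, inferInstance, inferInstance, T, Empty.elim, a, hT, by simp,
      by simp [evalQuad_eq_sum]⟩
end

section
variable {H E : Type u} [NormedAddCommGroup H] [InnerProductSpace ℂ H]
  [NormedAddCommGroup E] [InnerProductSpace ℂ E] {X : Submodule ℂ (H →L[ℂ] H)}

theorem mContr_of_norm_le_one {x : X} (hx : ‖x‖ ≤ 1) : MContr fun _ _ : Unit => x := fun ξ => by
  simp only [Finset.univ_unique, Finset.sum_singleton]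
  exact pow_le_pow_left₀ (norm_nonneg _) (((x : H →L[ℂ] H).le_of_opNorm_le hx _).trans_eq
    (one_mul _)) 2

theorem IsAdm.exists_maximal {Q : X ⊗[ℂ] E → ℝ} (hQ : IsAdm Q) :
    ∃ Q', Q ≤ Q' ∧ Maximal IsAdm Q' := by
  refine zorn_le_nonempty₀ {Q : X ⊗[ℂ] E → ℝ | IsAdm Q} (fun c hc hcc q₀ hq₀ => ?_) Q hQ
  have : Nonempty c := ⟨⟨q₀, hq₀⟩⟩
  have : IsDirectedOrder c := ⟨fun a b => (hcc.total a.2 b.2).elim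
    (fun h => ⟨b, h, le_rfl⟩) fun h => ⟨a, le_rfl, h⟩⟩
  have hbdd : ∀ v, BddAbove (Set.range fun q : c => q.1 v) := fun v => by
    obtain ⟨κ, _, w, ξ, hw, rfl⟩ := exists_mContr_row v
    refine ⟨∑ j, ‖ξ j‖ ^ 2, ?_⟩
    rintro _ ⟨q, rfl⟩
    simpa using (hc q.2).bound _ _ w hw ξ
  have hlim : ∀ v, Filter.Tendsto (fun q : c => q.1 v) Filter.atTop (nhds (⨆ q : c, q.1 v)) :=
    fun v => tendsto_atTop_ciSup (fun q q' h => h v) (hbdd v)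
  refine ⟨fun v => ⨆ q : c, q.1 v, ⟨⟨fun v => ?_, fun a v => ?_, fun v w => ?_, fun v w t => ?_⟩,
    fun ι κ _ _ v hv ξ => ?_⟩, fun q hq v => le_ciSup (hbdd v) ⟨q, hq⟩⟩
  · exact ge_of_tendsto' (hlim v) fun q => (hc q.2).quad.nonneg v
  · exact tendsto_nhds_unique (hlim _)
      (((hlim v).const_mul _).congr fun q => ((hc q.2).quad.smul a v).symm)
  · exact tendsto_nhds_unique ((hlim _).add (hlim _))
      ((((hlim v).add (hlim w)).const_mul 2).congr
        fun q => ((hc q.2).quad.parallelogram v w).symm)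
  · exact tendsto_nhds_unique (hlim _)
      ((((hlim v).add ((((hlim _).sub (hlim v)).sub (hlim w)).const_mul t)).add
        ((hlim w).const_mul _)).congr fun q => ((hc q.2).quad.line v w t).symm)
  · exact le_of_tendsto' (tendsto_finsetSum _ fun i _ => hlim _)
      fun q => (hc q.2).bound ι κ v hv ξ

theorem exists_extension_of_denseRange {V W K : Type*} [AddCommGroup V] [Module ℂ V]
    [AddCommGroup W] [Module ℂ W] [NormedAddCommGroup K] [InnerProductSpace ℂ K] [CompleteSpace K]
    {L : V →ₗ[ℂ] K} (hd : DenseRange L) (g : W →ₗ[ℂ] V →ₗ[ℂ] V)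
    (hbd : ∀ x, ∃ C, ∀ v, ‖L (g x v)‖ ≤ C * ‖L v‖) :
    ∃ t : W →ₗ[ℂ] K →L[ℂ] K, ∀ x v, t x (L v) = L (g x v) := by
  let t : W → K →L[ℂ] K := fun x => (L ∘ₗ g x).extendOfNorm L
  have ht : ∀ x v, t x (L v) = L (g x v) := fun x v => LinearMap.extendOfNorm_eq hd (hbd x) v
  have hext : ∀ A B : K →L[ℂ] K, (∀ v, A (L v) = B (L v)) → A = B := fun A B h =>
    ContinuousLinearMap.ext fun k => congrFun (hd.equalizer A.continuous B.continuous
      (funext h)) k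
  exact ⟨{ toFun := t
           map_add' := fun x y => hext _ _ fun v => by simp [ht]
           map_smul' := fun c x => hext _ _ fun v => by simp [ht] }, ht⟩

theorem exists_rep_of_maximal {φ : X →ₗ[ℂ] X →ₗ[ℂ] X} (hφ : LeftContractive φ)
    {Q : X ⊗[ℂ] E → ℝ} (hQ : Maximal IsAdm Q) :
    ∃ (K : Type u) (_ : NormedAddCommGroup K) (_ : InnerProductSpace ℂ K) (_ : CompleteSpace K)
      (L : X ⊗[ℂ] E →ₗ[ℂ] K) (t : X →ₗ[ℂ] K →L[ℂ] K), DenseRange L ∧ (∀ v, ‖L v‖ ^ 2 = Q v) ∧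
      (∀ x v, t x (L v) = L ((φ x).rTensor E v)) ∧
      ∀ (κ : Type) [Fintype κ] (T : Matrix κ κ X), MContr T → OpContr fun i j => t (T i j) := by
  have hinv : ∀ (κ : Type) [Fintype κ] (T : Matrix κ κ X), MContr T → ∀ a : κ → X ⊗[ℂ] E,
      ∑ k, Q (∑ l, (φ (T k l)).rTensor E (a l)) ≤ ∑ k, Q (a k) := by
    obtain ⟨Q', hQ', hle, h⟩ := hQ.prop.exists_dominating hφ
    rwa [← hQ.eq_of_le hQ' hle] at h
  obtain ⟨K, nK, iK, cK, L, hd, hL⟩ := hQ.prop.quad.exists_linearMap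
  have hbd : ∀ x v, ‖L ((φ x).rTensor E v)‖ ≤ (‖x‖ + 1) * ‖L v‖ := fun x v => by
    have hc : 0 < ‖x‖ + 1 := by positivity
    have hc' : ((‖x‖ + 1 : ℝ) : ℂ) ≠ 0 := by exact_mod_cast hc.ne'
    have hnc : ‖((‖x‖ + 1 : ℝ) : ℂ)‖ = ‖x‖ + 1 := by
      rw [Complex.norm_real, Real.norm_of_nonneg hc.le]
    have hy : ‖((‖x‖ + 1 : ℝ) : ℂ)⁻¹ • x‖ ≤ 1 := by
      change ‖((‖x‖ + 1 : ℝ) : ℂ)⁻¹ • (x : H →L[ℂ] H)‖ ≤ 1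
      rw [norm_smul, norm_inv, hnc, inv_mul_le_iff₀ hc]
      change ‖x‖ ≤ _
      linarith
    have h := hinv Unit _ (mContr_of_norm_le_one hy) fun _ => v
    simp only [Finset.univ_unique, Finset.sum_singleton, map_smul, LinearMap.rTensor_smul,
      LinearMap.smul_apply] at h
    rw [← hL, ← hL, map_smul] at h
    have h' := le_of_sq_le_sq h (norm_nonneg _)
    rwa [norm_smul, norm_inv, hnc, inv_mul_le_iff₀ hc] at h'
  let g : X →ₗ[ℂ] (X ⊗[ℂ] E) →ₗ[ℂ] (X ⊗[ℂ] E) := (LinearMap.rTensorHom E).comp φ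
  have hbd' : ∀ x, ∃ C, ∀ v, ‖L (g x v)‖ ≤ C * ‖L v‖ := fun x => ⟨_, hbd x⟩
  obtain ⟨t, ht⟩ := exists_extension_of_denseRange (V := X ⊗[ℂ] E) (L := L) hd g hbd'
  refine ⟨K, nK, iK, cK, L, t, hd, hL, ht, fun κ _ T hT ξ => ?_⟩
  have hdκ : DenseRange fun (a : κ → X ⊗[ℂ] E) k => L (a k) := DenseRange.piMap fun _ => hd
  refine hdκ.induction_on (p := fun ξ => ∑ i, ‖∑ j, t (T i j) (ξ j)‖ ^ 2 ≤ ∑ j, ‖ξ j‖ ^ 2) ξ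
    (isClosed_le (by fun_prop) (by fun_prop)) fun a => ?_
  have h := hinv κ T hT a
  simp only [← hL, map_sum] at h
  simpa only [show ∀ x v, t x (L v) = L ((φ x).rTensor E v) from ht] using h

end

section
variable {E : Type*} [NormedAddCommGroup E] [InnerProductSpace ℂ E]

/-- The operator on a Hilbert space direct sum given by a matrix of operators. -/
noncomputable def blockOperator {n : ℕ} :
    Matrix (Fin n) (Fin n) (E →L[ℂ] E) →ₐ[ℂ]
      (PiLp 2 (fun _ : Fin n => E) →L[ℂ] PiLp 2 (fun _ : Fin n => E)) where
  toFun M := ((PiLp.continuousLinearEquiv 2 ℂ fun _ : Fin n => E).symm :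
    (Fin n → E) →L[ℂ] PiLp 2 (fun _ : Fin n => E)) ∘L
      ContinuousLinearMap.pi fun i => ∑ j, M i j ∘L PiLp.proj 2 (fun _ : Fin n => E) j
  map_one' := by
    ext x i
    simp [Matrix.one_apply, apply_ite, ite_apply]
  map_mul' M N := by
    ext x i
    simp [Matrix.mul_apply, map_sum]
    exact Finset.sum_comm
  map_zero' := by ext; simp
  map_add' M N := by ext; simp [Finset.sum_add_distrib]
  commutes' c := by
    ext x i
    simp [Matrix.algebraMap_matrix_apply, apply_ite, ite_apply]

theorem blockOperator_apply {n : ℕ} (M : Matrix (Fin n) (Fin n) (E →L[ℂ] E))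
    (x : PiLp 2 (fun _ : Fin n => E)) (i : Fin n) : blockOperator M x i = ∑ j, M i j (x j) := by
  simp [blockOperator]

theorem bijective_blockOperator {n : ℕ} :
    Function.Bijective (blockOperator (E := E) (n := n)) := by
  constructor
  · intro M N h
    ext i j x
    have := congrArg (fun A => A (PiLp.single 2 j x) i) h
    simpa [blockOperator_apply, Pi.single_apply, apply_ite] using this
  · intro A
    refine ⟨Matrix.of fun i j => PiLp.proj 2 (fun _ : Fin n => E) i ∘L A ∘L
      ((PiLp.continuousLinearEquiv 2 ℂ fun _ : Fin n => E).symm :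
        (Fin n → E) →L[ℂ] PiLp 2 (fun _ : Fin n => E)) ∘L
          ContinuousLinearMap.single ℂ (fun _ : Fin n => E) j, ?_⟩
    ext x i
    rw [blockOperator_apply]
    have hx : x = ∑ j, WithLp.toLp 2 (Pi.single j (x j)) := by
      ext k; simp [Pi.single_apply]
    conv_rhs => rw [hx]
    simp

theorem blockOperator_star [CompleteSpace E] {n : ℕ} (M : Matrix (Fin n) (Fin n) (E →L[ℂ] E)) :
    blockOperator (star M) = star (blockOperator M) := by
  rw [ContinuousLinearMap.star_eq_adjoint, ContinuousLinearMap.eq_adjoint_iff]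
  intro x y
  simp only [PiLp.inner_apply, blockOperator_apply, sum_inner, inner_sum]
  rw [Finset.sum_comm]
  simp [Matrix.star_apply, ContinuousLinearMap.star_eq_adjoint,
      ContinuousLinearMap.adjoint_inner_left]

theorem cstarMatrixNorm_eq_norm_blockOperator [CompleteSpace E] {n : ℕ}
    (M : Matrix (Fin n) (Fin n) (E →L[ℂ] E)) : cstarMatrixNorm M = ‖blockOperator M‖ := by
  have h : spectralRadius ℂ (star M * M) =
      spectralRadius ℂ (star (blockOperator M) * blockOperator M) := by
    rw [← blockOperator_star, ← map_mul, spectralRadius, spectralRadius]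
    have := AlgEquiv.spectrum_eq (AlgEquiv.ofBijective blockOperator bijective_blockOperator)
      (star M * M)
    rw [← this]
    rfl
  rw [cstarMatrixNorm, h, CStarAlgebra.toReal_spectralRadius_star_mul_self_eq_norm_sq,
    Real.sqrt_sq (norm_nonneg _)]

theorem cstarMatrixNorm_le_iff [CompleteSpace E] {n : ℕ}
    {M : Matrix (Fin n) (Fin n) (E →L[ℂ] E)} {c : ℝ} (hc : 0 ≤ c) :
    cstarMatrixNorm M ≤ c ↔
      ∀ ξ : Fin n → E, ∑ i, ‖∑ j, M i j (ξ j)‖ ^ 2 ≤ c ^ 2 * ∑ j, ‖ξ j‖ ^ 2 := by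
  have h : ∀ ξ : Fin n → E, ‖blockOperator M (WithLp.toLp 2 ξ)‖ ≤ c * ‖WithLp.toLp 2 ξ‖ ↔
      ∑ i, ‖∑ j, M i j (ξ j)‖ ^ 2 ≤ c ^ 2 * ∑ j, ‖ξ j‖ ^ 2 := fun ξ => by
    rw [← pow_le_pow_iff_left₀ (norm_nonneg _) (by positivity) two_ne_zero, mul_pow,
      PiLp.norm_sq_eq_of_L2, PiLp.norm_sq_eq_of_L2]
    simp only [blockOperator_apply]
  rw [cstarMatrixNorm_eq_norm_blockOperator, ContinuousLinearMap.opNorm_le_iff hc]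
  exact ⟨fun H ξ => (h ξ).1 (H _), fun H x => (h x.ofLp).2 (H _)⟩
end

section
variable {H E : Type u} [NormedAddCommGroup H] [InnerProductSpace ℂ H]
  [NormedAddCommGroup E] [InnerProductSpace ℂ E] {X : Submodule ℂ (H →L[ℂ] H)}

theorem OpContr.submatrix {F G ι κ ι' κ' : Type*} [NormedAddCommGroup F] [InnerProductSpace ℂ F]
    [NormedAddCommGroup G] [InnerProductSpace ℂ G] [Fintype ι] [Fintype κ] [Fintype ι']
    [Fintype κ'] {v : ι → κ → (F →L[ℂ] G)} (hv : OpContr v) (p : ι' ≃ ι) (q : κ' ≃ κ) :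
    OpContr fun i j => v (p i) (q j) := fun ξ => by
  have h := hv fun j => ξ (q.symm j)
  rw [← p.sum_comp, ← q.sum_comp] at h
  refine le_trans (le_of_eq (Finset.sum_congr rfl fun i _ => ?_)) (h.trans_eq (by simp))
  rw [← q.sum_comp]
  simp

theorem cstarMatrixNorm_le_one_iff [CompleteSpace E] {n : ℕ}
    {M : Matrix (Fin n) (Fin n) (E →L[ℂ] E)} :
    cstarMatrixNorm M ≤ 1 ↔ OpContr fun i j => M i j := by
  rw [cstarMatrixNorm_le_iff zero_le_one]
  simp [OpContr]

theorem MContr.sum_map₂ [CompleteSpace H] {φ : X →ₗ[ℂ] X →ₗ[ℂ] X}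
    (hφ : ∀ (n : ℕ) (a b : Matrix (Fin n) (Fin n) X),
      cstarMatrixNorm (Matrix.of fun i j => ((∑ k, φ (a i k) (b k j) : X) : H →L[ℂ] H)) ≤
        cstarMatrixNorm (a.map (fun x => (x : H →L[ℂ] H))) *
          cstarMatrixNorm (b.map (fun x => (x : H →L[ℂ] H))))
    {ι κ μ : Type*} [Fintype ι] [Fintype κ] [Fintype μ] {a : Matrix ι κ X} {b : Matrix κ μ X}
    (ha : MContr a) (hb : MContr b) :
    MContr (Matrix.of fun i j => ∑ k, φ (a i k) (b k j)) := by
  let e := (Fintype.equivFin (ι ⊕ (κ ⊕ μ))).symm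
  let A : Matrix (ι ⊕ (κ ⊕ μ)) (ι ⊕ (κ ⊕ μ)) X := Matrix.fromBlocks 0 (Matrix.fromCols a 0) 0 0
  let B : Matrix (ι ⊕ (κ ⊕ μ)) (ι ⊕ (κ ⊕ μ)) X :=
    Matrix.fromBlocks 0 0 0 (Matrix.fromBlocks 0 b 0 0)
  have hA : MContr A := fun ξ => by
    simp only [A, Fintype.sum_sum_type, Matrix.fromBlocks_apply₁₁, Matrix.fromBlocks_apply₁₂,
      Matrix.fromBlocks_apply₂₁, Matrix.fromBlocks_apply₂₂, Matrix.zero_apply,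
      Matrix.fromCols_apply_inl, Matrix.fromCols_apply_inr, Submodule.coe_zero, zero_apply,
      Finset.sum_const_zero, zero_add, add_zero, norm_zero, ne_eq, OfNat.ofNat_ne_zero,
      not_false_eq_true, zero_pow]
    exact (ha _).trans (by
      nlinarith [Finset.sum_nonneg fun i (_ : i ∈ Finset.univ) => sq_nonneg ‖ξ (.inl i)‖,
        Finset.sum_nonneg fun i (_ : i ∈ Finset.univ) => sq_nonneg ‖ξ (.inr (.inr i))‖])
  have hB : MContr B := fun ξ => by
    simp only [B, Fintype.sum_sum_type, Matrix.fromBlocks_apply₁₁, Matrix.fromBlocks_apply₁₂,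
      Matrix.fromBlocks_apply₂₁, Matrix.fromBlocks_apply₂₂, Matrix.zero_apply, Submodule.coe_zero,
      zero_apply, Finset.sum_const_zero, zero_add, add_zero, norm_zero, ne_eq,
      OfNat.ofNat_ne_zero, not_false_eq_true, zero_pow]
    exact (hb _).trans (by
      nlinarith [Finset.sum_nonneg fun i (_ : i ∈ Finset.univ) => sq_nonneg ‖ξ (.inl i)‖,
        Finset.sum_nonneg fun i (_ : i ∈ Finset.univ) => sq_nonneg ‖ξ (.inr (.inl i))‖])
  have hA' := cstarMatrixNorm_le_one_iff.2 (hA.submatrix e e)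
  have hB' := cstarMatrixNorm_le_one_iff.2 (hB.submatrix e e)
  have hn := (hφ _ (A.submatrix e e) (B.submatrix e e)).trans
    (mul_le_one₀ hA' (Real.sqrt_nonneg _) hB')
  have h := (cstarMatrixNorm_le_one_iff.1 hn).submatrix e.symm e.symm
  intro ξ
  have hξ := h (Sum.elim 0 (Sum.elim 0 ξ))
  simp only [Matrix.of_apply, Matrix.submatrix_apply, Equiv.apply_symm_apply] at hξ
  have hs : ∀ x y, ∑ k, φ (A x (e k)) (B (e k) y) = ∑ k, φ (A x k) (B k y) := fun x y =>
    e.sum_comp fun k => φ (A x k) (B k y)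
  simp only [hs] at hξ
  simp only [A, B, Fintype.sum_sum_type, Matrix.fromBlocks_apply₁₁, Matrix.fromBlocks_apply₁₂,
    Matrix.fromBlocks_apply₂₁, Matrix.fromBlocks_apply₂₂, Matrix.zero_apply,
    Matrix.fromCols_apply_inl, Submodule.coe_zero, zero_apply, map_zero, LinearMap.zero_apply,
        Sum.elim_inl, Sum.elim_inr, Pi.zero_apply,
    Finset.sum_const_zero, zero_add, add_zero, norm_zero, ne_eq,
    OfNat.ofNat_ne_zero, not_false_eq_true, zero_pow] at hξ
  exact hξ

theorem leftContractive_of_tendsto [CompleteSpace H] {φ : X →ₗ[ℂ] X →ₗ[ℂ] X}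
    (hφ : ∀ (n : ℕ) (a b : Matrix (Fin n) (Fin n) X),
      cstarMatrixNorm (Matrix.of fun i j => ((∑ k, φ (a i k) (b k j) : X) : H →L[ℂ] H)) ≤
        cstarMatrixNorm (a.map (fun x => (x : H →L[ℂ] H))) *
          cstarMatrixNorm (b.map (fun x => (x : H →L[ℂ] H))))
    {J : Type*} {l : Filter J} [l.NeBot] {f : J → X} (hf1 : ∀ β, ‖f β‖ ≤ 1)
    (hf : ∀ x : X, Filter.Tendsto (fun β => φ (f β) x) l (nhds x)) : LeftContractive φ := by
  classical
  intro ι κ ν _ _ _ T b a hT hba ξ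
  have hd : ∀ β, MContr (Matrix.diagonal fun _ : ι => f β) := fun β η => by
    simp only [Matrix.diagonal_apply]
    refine Finset.sum_le_sum fun i _ => ?_
    have : ∑ j, ((if i = j then f β else 0 : X) : H →L[ℂ] H) (η j) = (f β : H →L[ℂ] H) (η i) := by
      rw [Finset.sum_eq_single i] <;> simp +contextual [eq_comm]
    rw [this]
    exact pow_le_pow_left₀ (norm_nonneg _) (((f β : H →L[ℂ] H).le_of_opNorm_le (hf1 β) _).trans_eq
      (one_mul _)) 2
  refine le_of_tendsto' (x := l) (f := fun β => ∑ i, ‖∑ j, ((Matrix.fromRows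
    (Matrix.of fun i j => φ (f β) (b i j)) (Matrix.of fun k j => ∑ l, φ (T k l) (a l j)) i j : X) :
      H →L[ℂ] H) (ξ j)‖ ^ 2) ?_ fun β => ?_
  · refine tendsto_finsetSum _ fun i _ => ((tendsto_finsetSum _ fun j _ => ?_).norm.pow 2)
    have : Filter.Tendsto (fun β => (Matrix.fromRows
      (Matrix.of fun i j => φ (f β) (b i j)) (Matrix.of fun k j => ∑ l,
          φ (T k l) (a l j)) i j : X)) l
      (nhds (Matrix.fromRows b (Matrix.of fun k j => ∑ l, φ (T k l) (a l j)) i j)) := by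
      rcases i with i | k
      · exact hf _
      · exact tendsto_const_nhds
    exact ((ContinuousLinearMap.apply ℂ H (ξ j)).continuous.tendsto _).comp
      ((continuous_subtype_val.tendsto _).comp this)
  · refine le_trans (le_of_eq ?_) (((hd β).fromBlocks hT).sum_map₂ hφ hba ξ)
    refine Finset.sum_congr rfl fun i _ => ?_
    congr 2
    refine Finset.sum_congr rfl fun j _ => ?_
    congr 2
    rcases i with i | k
    · simp only [Matrix.fromRows_apply_inl, Matrix.of_apply, Fintype.sum_sum_type,
        Matrix.fromBlocks_apply₁₁, Matrix.fromBlocks_apply₁₂, Matrix.fromRows_apply_inr,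
        Matrix.zero_apply, map_zero, LinearMap.zero_apply, Finset.sum_const_zero, add_zero,
        Matrix.diagonal_apply]
      rw [Finset.sum_eq_single i] <;> simp +contextual [eq_comm]
    · simp
end

/-- Weak convergence in a Hilbert space. -/
def WeakTendsto {I K : Type*} [NormedAddCommGroup K] [InnerProductSpace ℂ K] (x : I → K)
    (l : Filter I) (y : K) : Prop :=
  ∀ z, Filter.Tendsto (fun α => inner ℂ z (x α)) l (nhds (inner ℂ z y))

section
variable {I K F : Type*} [NormedAddCommGroup K] [InnerProductSpace ℂ K]
  [NormedAddCommGroup F] [InnerProductSpace ℂ F] {l : Filter I}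

theorem WeakTendsto.unique [l.NeBot] {x : I → K} {y y' : K} (h : WeakTendsto x l y)
    (h' : WeakTendsto x l y') : y = y' :=
  ext_inner_left ℂ fun z => tendsto_nhds_unique (h z) (h' z)

theorem Filter.Tendsto.weakTendsto {x : I → K} {y : K} (h : Filter.Tendsto x l (nhds y)) :
    WeakTendsto x l y := fun _ => tendsto_const_nhds.inner h

theorem WeakTendsto.map [CompleteSpace K] [CompleteSpace F] {x : I → K} {y : K}
    (h : WeakTendsto x l y) (A : K →L[ℂ] F) : WeakTendsto (fun α => A (x α)) l (A y) := fun z => by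
  simpa only [ContinuousLinearMap.adjoint_inner_left] using h (A.adjoint z)

theorem exists_weakTendsto [CompleteSpace K] (U : Ultrafilter I) {x : I → K} {r : ℝ}
    (hx : ∀ α, ‖x α‖ ≤ r) : ∃ y, ‖y‖ ≤ r ∧ WeakTendsto x U y := by
  let g : I → WeakDual ℂ K := fun α => StrongDual.toWeakDual (InnerProductSpace.toDual ℂ K (x α))
  have hg : ∀ α, g α ∈ WeakDual.toStrongDual ⁻¹' Metric.closedBall (0 : StrongDual ℂ K) r :=
    fun α => by simpa [g] using hx α
  obtain ⟨y', hy', hle⟩ := (WeakDual.isCompact_closedBall (𝕜 := ℂ) (0 : StrongDual ℂ K) r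
    ).ultrafilter_le_nhds (U.map g) (Filter.le_principal_iff.2 (Filter.mem_map.2
      (Filter.Eventually.of_forall hg)))
  refine ⟨(InnerProductSpace.toDual ℂ K).symm (WeakDual.toStrongDual y'), by simpa using hy',
    fun z => ?_⟩
  have h1 : Filter.Tendsto (fun α => g α z) U (nhds (y' z)) :=
    ((WeakDual.eval_continuous z).tendsto y').comp hle
  have h2 := (RCLike.continuous_conj (K := ℂ)).tendsto _ |>.comp h1
  have h3 : inner ℂ z ((InnerProductSpace.toDual ℂ K).symm (WeakDual.toStrongDual y')) =
      (starRingEnd ℂ) (y' z) := by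
    rw [← inner_conj_symm, InnerProductSpace.toDual_symm_apply]
    rfl
  rw [h3]
  refine h2.congr fun α => ?_
  change (starRingEnd ℂ) (inner ℂ (x α) z) = _
  rw [inner_conj_symm]

theorem exists_weakTendsto_linearMap [CompleteSpace F] (U : Ultrafilter I) (A : I → K →ₗ[ℂ] F)
    (hA : ∀ α k, ‖A α k‖ ≤ ‖k‖) :
    ∃ J : K →ₗ[ℂ] F, (∀ k, ‖J k‖ ≤ ‖k‖) ∧ ∀ k, WeakTendsto (fun α => A α k) U (J k) := by
  choose J hJ hJ' using fun k => exists_weakTendsto U fun α => hA α k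
  refine ⟨{ toFun := J, map_add' := fun x y => ?_, map_smul' := fun c x => ?_ }, hJ, hJ'⟩
  · refine (hJ' _).unique fun z => ?_
    simpa only [map_add, inner_add_right] using (hJ' x z).add (hJ' y z)
  · refine (hJ' _).unique fun z => ?_
    simpa only [map_smul, inner_smul_right, RingHom.id_apply] using (hJ' x z).const_mul c

theorem eq_of_contraction {R : K →ₗ[ℂ] F} (hR : ∀ k, ‖R k‖ ≤ ‖k‖) {w p : K} (hRp : R p = R w)
    (hp : ‖p‖ ≤ ‖R w‖) (hw : ‖w‖ ≤ ‖R w‖) : w = p := by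
  have h1 := hR (w + p)
  have h2 := parallelogram_law_with_norm ℂ w p
  rw [map_add, hRp, ← two_smul ℂ, norm_smul, Complex.norm_ofNat] at h1
  have h3 : ‖w - p‖ * ‖w - p‖ ≤ 0 := by
    nlinarith [norm_nonneg w, norm_nonneg p, norm_nonneg (R w)]
  rw [← sub_eq_zero, ← norm_eq_zero]
  nlinarith [mul_self_nonneg ‖w - p‖]

theorem tendsto_of_denseRange {V : Type*} [AddCommGroup V] [Module ℂ V] {L : V →ₗ[ℂ] K}
    (hd : DenseRange L) {A : I → K →L[ℂ] K} (hA : ∀ α k, ‖A α k‖ ≤ ‖k‖)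
    (h : ∀ v, Filter.Tendsto (fun α => A α (L v)) l (nhds (L v))) (k : K) :
    Filter.Tendsto (fun α => A α k) l (nhds k) := by
  rw [Metric.tendsto_nhds]
  intro ε hε
  obtain ⟨v, hv⟩ := hd.exists_dist_lt k (show 0 < ε / 3 by positivity)
  filter_upwards [Metric.tendsto_nhds.1 (h v) (ε / 3) (by positivity)] with α hα
  have h1 := hA α (k - L v)
  rw [map_sub, ← dist_eq_norm, ← dist_eq_norm] at h1
  have h2 := dist_triangle4 (A α k) (A α (L v)) (L v) k
  rw [dist_comm (L v) k] at h2
  linarith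
end

section
variable {H E K : Type u} [NormedAddCommGroup H] [InnerProductSpace ℂ H]
  [NormedAddCommGroup E] [InnerProductSpace ℂ E] [NormedAddCommGroup K] [InnerProductSpace ℂ K]
  {X : Submodule ℂ (H →L[ℂ] H)}

theorem IsAdm.tmul_le {Q : X ⊗[ℂ] E → ℝ} (hQ : IsAdm Q) (x : X) (h : E) :
    Q (x ⊗ₜ h) ≤ ‖x‖ ^ 2 * ‖h‖ ^ 2 := by
  rcases eq_or_ne x 0 with rfl | hx
  · have := hQ.quad.smul 0 (0 ⊗ₜ h)
    simp only [zero_smul, TensorProduct.zero_tmul] at this ⊢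
    rw [this]
    simp
  · have hx' : ((‖x‖ : ℝ) : ℂ) ≠ 0 := by simpa using hx
    have hc : ‖((‖x‖ : ℝ) : ℂ)‖ = ‖x‖ := by simp
    have h1 : ‖((‖x‖ : ℝ) : ℂ)⁻¹ • x‖ ≤ 1 := by
      change ‖((‖x‖ : ℝ) : ℂ)⁻¹ • (x : H →L[ℂ] H)‖ ≤ 1
      rw [norm_smul, norm_inv, hc]
      exact inv_mul_le_one
    have h2 := hQ.bound _ _ _ (mContr_of_norm_le_one h1) fun _ => ((‖x‖ : ℝ) : ℂ) • h
    simp only [Finset.univ_unique, Finset.sum_singleton, inv_smul_tmul_smul hx'] at h2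
    rwa [norm_smul, mul_pow, hc] at h2

theorem IsAdm.norm_tmul_le {L : X ⊗[ℂ] E →ₗ[ℂ] K} (hL : IsAdm fun v => ‖L v‖ ^ 2) (x : X) (h : E) :
    ‖L (x ⊗ₜ h)‖ ≤ ‖x‖ * ‖h‖ := by
  have := hL.tmul_le x h
  rw [← mul_pow] at this
  exact le_of_sq_le_sq this (by positivity)

theorem IsAdm.continuous_tmul {L : X ⊗[ℂ] E →ₗ[ℂ] K} (hL : IsAdm fun v => ‖L v‖ ^ 2) (h : E) :
    Continuous fun x : X => L (x ⊗ₜ h) :=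
  AddMonoidHomClass.continuous_of_bound (L ∘ₗ (TensorProduct.mk ℂ X E).flip h) ‖h‖ fun x =>
    (hL.norm_tmul_le x h).trans_eq (mul_comm _ _)

end

section
variable {H E K : Type u} [NormedAddCommGroup H] [InnerProductSpace ℂ H]
  [NormedAddCommGroup E] [InnerProductSpace ℂ E] [NormedAddCommGroup K] [InnerProductSpace ℂ K]
  {X : Submodule ℂ (H →L[ℂ] H)} {φ : X →ₗ[ℂ] X →ₗ[ℂ] X}

theorem exists_contraction_of_denseRange {V K F : Type*} [AddCommGroup V] [Module ℂ V]
    [NormedAddCommGroup K] [NormedSpace ℂ K] [NormedAddCommGroup F] [NormedSpace ℂ F]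
    [CompleteSpace F] {L : V →ₗ[ℂ] K} (hd : DenseRange L) {m : V →ₗ[ℂ] F}
    (h : ∀ v, ‖m v‖ ≤ ‖L v‖) :
    ∃ R : K →L[ℂ] F, (∀ k, ‖R k‖ ≤ ‖k‖) ∧ ∀ v, R (L v) = m v := by
  have h' : ∀ v, ‖m v‖ ≤ 1 * ‖L v‖ := by simpa using h
  exact ⟨m.extendOfNorm L, fun k => (LinearMap.norm_extendOfNorm_apply_le hd 1 h' k).trans_eq
    (one_mul _), LinearMap.extendOfNorm_eq hd ⟨1, h'⟩⟩

/-- The operators induced by left multiplication on the Hilbert space of a maximal admissible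
quadratic form. -/
structure IsMaximalRep (φ : X →ₗ[ℂ] X →ₗ[ℂ] X) (L : X ⊗[ℂ] E →ₗ[ℂ] K)
    (t : X →ₗ[ℂ] K →L[ℂ] K) : Prop where
  dense : DenseRange L
  maximal : Maximal IsAdm fun v => ‖L v‖ ^ 2
  apply : ∀ x v, t x (L v) = L ((φ x).rTensor E v)
  contr : ∀ (ι κ : Type) [Fintype ι] [Fintype κ] (T : Matrix ι κ X), MContr T →
    OpContr fun i j => t (T i j)

theorem exists_isMaximalRep (hφ : LeftContractive φ) {Q : X ⊗[ℂ] E → ℝ} (hQ : IsAdm Q) :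
    ∃ (K : Type u) (_ : NormedAddCommGroup K) (_ : InnerProductSpace ℂ K) (_ : CompleteSpace K)
      (L : X ⊗[ℂ] E →ₗ[ℂ] K) (t : X →ₗ[ℂ] K →L[ℂ] K),
      IsMaximalRep φ L t ∧ ∀ v, Q v ≤ ‖L v‖ ^ 2 := by
  obtain ⟨Q', hle, hQ'⟩ := hQ.exists_maximal
  obtain ⟨K, nK, iK, cK, L, t, hd, hL, ht, hT⟩ := exists_rep_of_maximal hφ hQ'
  have hLQ : (fun v => ‖L v‖ ^ 2) = Q' := funext hL
  refine ⟨K, nK, iK, cK, L, t, ⟨hd, hLQ ▸ hQ', ht, fun ι κ _ _ T hTc ξ => ?_⟩,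
    fun v => (hle v).trans_eq (hL v).symm⟩
  have hTc' : MContr (Matrix.fromBlocks 0 T 0 0 : Matrix (ι ⊕ κ) (ι ⊕ κ) X) := fun η => by
    have h0 : 0 ≤ ∑ i, ‖η (.inl i)‖ ^ 2 := Finset.sum_nonneg fun i _ => sq_nonneg _
    simpa using (hTc fun j => η (.inr j)).trans (le_add_of_nonneg_left h0)
  simpa using hT _ _ hTc' (Sum.elim 0 ξ)

namespace IsMaximalRep
variable {L : X ⊗[ℂ] E →ₗ[ℂ] K} {t : X →ₗ[ℂ] K →L[ℂ] K}

theorem norm_le (h : IsMaximalRep φ L t) {x : X} (hx : ‖x‖ ≤ 1) (k : K) : ‖t x k‖ ≤ ‖k‖ := by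
  have := h.contr _ _ _ (mContr_of_norm_le_one hx) fun _ => k
  simp only [Finset.univ_unique, Finset.sum_singleton] at this
  exact le_of_sq_le_sq this (norm_nonneg _)

theorem apply_tmul (h : IsMaximalRep φ L t) (x y : X) (k : E) :
    t x (L (y ⊗ₜ k)) = L (φ x y ⊗ₜ k) := by
  rw [h.apply, LinearMap.rTensor_tmul]

theorem tendsto (h : IsMaximalRep φ L t) {J : Type*} {l : Filter J} {f : J → X}
    (hf1 : ∀ β, ‖f β‖ ≤ 1) (hf : ∀ x : X, Filter.Tendsto (fun β => φ (f β) x) l (nhds x)) (k : K) :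
    Filter.Tendsto (fun β => t (f β) k) l (nhds k) := by
  refine tendsto_of_denseRange (V := X ⊗[ℂ] E) (L := L) h.dense
      (fun β => h.norm_le (hf1 β)) (fun v => ?_) k
  induction v using TensorProduct.induction_on with
  | zero =>
    refine tendsto_const_nhds.congr fun β => ?_
    rw [L.map_zero, ContinuousLinearMap.map_zero]
  | tmul x k =>
    simp only [h.apply_tmul]
    exact ((h.maximal.prop.continuous_tmul k).tendsto x).comp (hf x)
  | add v w hv hw => simpa only [map_add] using hv.add hw

/-- If `e` is a right approximate unit, the vectors `L (e α ⊗ₜ k)` converge weakly to the value of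
a contraction which `t` carries back to `L`. -/
theorem exists_weakTendsto [CompleteSpace K] (h : IsMaximalRep φ L t) {I : Type*}
    (U : Ultrafilter I) {e : I → X} (he1 : ∀ α, ‖e α‖ ≤ 1)
    (he : ∀ x : X, Filter.Tendsto (fun α => φ x (e α)) U (nhds x)) :
    ∃ c : E →ₗ[ℂ] K, (∀ k, ‖c k‖ ≤ ‖k‖) ∧ ∀ x k, t x (c k) = L (x ⊗ₜ k) := by
  obtain ⟨c, hc, hcw⟩ := exists_weakTendsto_linearMap U (fun α => L ∘ₗ TensorProduct.mk ℂ X E (e α))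
    fun α k => (h.maximal.prop.norm_tmul_le (e α) k).trans
      (mul_le_of_le_one_left (norm_nonneg _) (he1 α))
  refine ⟨c, hc, fun x k => ((hcw k).map (t x)).unique (Filter.Tendsto.weakTendsto ?_)⟩
  simp only [LinearMap.comp_apply, TensorProduct.mk_apply, h.apply_tmul]
  exact ((h.maximal.prop.continuous_tmul k).tendsto x).comp (he x)

/-- The linear map on the tensor product associated with a family of operators. -/
noncomputable def evalMap (t : X →ₗ[ℂ] K →L[ℂ] K) : X ⊗[ℂ] K →ₗ[ℂ] K :=
  TensorProduct.lift ((ContinuousLinearMap.coeLM ℂ).comp t)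

theorem map_mul [CompleteSpace K] (h : IsMaximalRep φ L t) (hφ : LeftContractive φ)
    {I J : Type*} (U : Ultrafilter I) {l : Filter J} [l.NeBot] {e : I → X} {f : J → X}
    (he1 : ∀ α, ‖e α‖ ≤ 1) (hf1 : ∀ β, ‖f β‖ ≤ 1)
    (he : ∀ x : X, Filter.Tendsto (fun α => φ x (e α)) U (nhds x))
    (hf : ∀ x : X, Filter.Tendsto (fun β => φ (f β) x) l (nhds x)) (x y : X) :
    t (φ x y) = t x * t y := by
  obtain ⟨c, hc, htc⟩ := h.exists_weakTendsto U he1 he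
  have hm : ∀ x k, evalMap t (x ⊗ₜ k) = t x k := fun x k => by simp [evalMap]
  have hm1 : IsAdm fun v => ‖evalMap t v‖ ^ 2 :=
    ⟨isHilbertQuad_norm_sq _, fun ι κ _ _ v hv ξ => by
      simpa only [map_sum, hm] using h.contr ι κ v hv ξ⟩
  obtain ⟨K₂, _, _, _, L₂, t₂, h₂, hle⟩ := exists_isMaximalRep hφ hm1
  have hle' : ∀ v, ‖evalMap t v‖ ≤ ‖L₂ v‖ := fun v =>
    le_of_sq_le_sq (hle v) (norm_nonneg _)
  obtain ⟨j, hj, htj⟩ := h₂.exists_weakTendsto U he1 he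
  obtain ⟨R, hR1, hR⟩ := exists_contraction_of_denseRange (V := X ⊗[ℂ] K) (L := L₂) h₂.dense
    (m := evalMap t) hle'
  have hRj : ∀ k, R (j k) = k := fun k => by
    refine tendsto_nhds_unique ?_ (h.tendsto hf1 hf k)
    refine ((R.continuous.tendsto _).comp (h₂.tendsto hf1 hf (j k))).congr fun β => ?_
    rw [Function.comp_apply, htj, hR, hm]
  have hcv : ∀ v, evalMap t (c.lTensor X v) = L v := fun v => by
    induction v using TensorProduct.induction_on with
    | zero => simp
    | tmul x k => rw [LinearMap.lTensor_tmul, hm, htc]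
    | add v w hv hw => simp only [_root_.map_add, hv, hw]
  let L₃ : X ⊗[ℂ] E →ₗ[ℂ] K₂ := L₂.comp (c.lTensor X)
  have hQ : IsAdm fun v => ‖L₂ (c.lTensor X v)‖ ^ 2 :=
    ⟨isHilbertQuad_norm_sq (V := X ⊗[ℂ] E) L₃, fun ι κ _ _ v hv ξ => by
      simp only [map_sum, LinearMap.lTensor_tmul]
      have := h₂.maximal.prop.bound ι κ v hv fun i => c (ξ i)
      simp only [map_sum] at this
      exact this.trans (Finset.sum_le_sum fun i _ => pow_le_pow_left₀ (norm_nonneg _) (hc _) 2)⟩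
  have hRv : ∀ v, R (L₂ (c.lTensor X v)) = L v := fun v => (hR _).trans (hcv v)
  have hQL : ∀ v, ‖L v‖ ^ 2 = ‖L₂ (c.lTensor X v)‖ ^ 2 := fun v =>
    congrFun (h.maximal.eq_of_le hQ fun w =>
      pow_le_pow_left₀ (norm_nonneg _) (by rw [← hRv]; exact hR1 _) 2) v
  have hjL : ∀ v, L₂ (c.lTensor X v) = j (L v) := fun v => by
    refine eq_of_contraction (R := R.toLinearMap) hR1 ?_ ?_ ?_
    · change R _ = R _
      rw [hRj, hRv]
    · change _ ≤ ‖R _‖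
      rw [hRv]
      exact hj _
    · change _ ≤ ‖R _‖
      rw [hRv]
      exact le_of_sq_le_sq (hQL v).ge (norm_nonneg _)
  have hjc : Continuous j := AddMonoidHomClass.continuous_of_bound j 1 fun k => by
    simpa using hj k
  have hcomm : ∀ x k, t₂ x (j k) = j (t x k) := fun x => congrFun <|
    h.dense.equalizer ((t₂ x).continuous.comp hjc) (hjc.comp (t x).continuous) <| funext fun v => by
      simp only [Function.comp_apply, ← hjL, h.apply, h₂.apply]
      congr 1
      induction v using TensorProduct.induction_on with
      | zero => simp
      | tmul x k => simp only [LinearMap.lTensor_tmul, LinearMap.rTensor_tmul]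
      | add v w hv hw => simp only [_root_.map_add, hv, hw]
  ext k
  have hk : j (t (φ x y) k) = j (t x (t y k)) := by
    rw [← hcomm, ← hcomm, ← hcomm, htj, htj, h₂.apply_tmul]
  rw [← hRj (t (φ x y) k), hk, hRj]
  rfl

end IsMaximalRep
end

theorem sum_norm_sq_le_of_contr {E F ι κ : Type*} [NormedAddCommGroup E] [InnerProductSpace ℂ E]
    [NormedAddCommGroup F] [InnerProductSpace ℂ F] [Fintype ι] [Fintype κ] {v : ι → κ → (E →L[ℂ] F)}
    {c : ℝ} (hc : c ≠ 0) (hv : OpContr fun i j => (c : ℂ)⁻¹ • v i j) (ξ : κ → E) :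
    ∑ i, ‖∑ j, v i j (ξ j)‖ ^ 2 ≤ c ^ 2 * ∑ j, ‖ξ j‖ ^ 2 := by
  have h := hv ξ
  simp only [smul_apply, ← Finset.smul_sum, norm_smul, mul_pow, norm_inv, Complex.norm_real,
    Real.norm_eq_abs, inv_pow, sq_abs, ← Finset.mul_sum] at h
  rwa [inv_mul_le_iff₀ (by positivity)] at h

section
variable {H : Type u} [NormedAddCommGroup H] [InnerProductSpace ℂ H]
  {X : Submodule ℂ (H →L[ℂ] H)} {φ : X →ₗ[ℂ] X →ₗ[ℂ] X}

theorem LeftContractive.exists_multiplicative_rep (hφ : LeftContractive φ)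
    {I J : Type*} (U : Ultrafilter I) {l : Filter J} [l.NeBot] {e : I → X} {f : J → X}
    (he1 : ∀ α, ‖e α‖ ≤ 1) (hf1 : ∀ β, ‖f β‖ ≤ 1)
    (he : ∀ x : X, Filter.Tendsto (fun α => φ x (e α)) U (nhds x))
    (hf : ∀ x : X, Filter.Tendsto (fun β => φ (f β) x) l (nhds x)) :
    ∃ (K : Type u) (_ : NormedAddCommGroup K) (_ : InnerProductSpace ℂ K) (_ : CompleteSpace K)
      (t : X →ₗ[ℂ] K →L[ℂ] K) (c : H →ₗ[ℂ] K), (∀ x y, t (φ x y) = t x * t y) ∧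
      (∀ (ι κ : Type) [Fintype ι] [Fintype κ] (T : Matrix ι κ X), MContr T →
        OpContr fun i j => t (T i j)) ∧ (∀ h, ‖c h‖ ≤ ‖h‖) ∧
      ∀ (κ : Type) [Fintype κ] (x : κ → X) (ξ : κ → H),
        ‖∑ j, (x j : H →L[ℂ] H) (ξ j)‖ ≤ ‖∑ j, t (x j) (c (ξ j))‖ := by
  let m : X ⊗[ℂ] H →ₗ[ℂ] H := IsMaximalRep.evalMap X.subtype
  have hm : ∀ x h, m (x ⊗ₜ[ℂ] h) = (x : H →L[ℂ] H) h := fun x h => by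
    simp [m, IsMaximalRep.evalMap]
  have hm1 : IsAdm fun v => ‖m v‖ ^ 2 :=
    ⟨isHilbertQuad_norm_sq (V := X ⊗[ℂ] H) m, fun ι κ _ _ v hv ξ => by
      simpa only [map_sum, hm] using hv ξ⟩
  obtain ⟨K, nK, iK, cK, L, t, ht, hle⟩ := exists_isMaximalRep hφ hm1
  obtain ⟨c, hc, htc⟩ := ht.exists_weakTendsto U he1 he
  refine ⟨K, nK, iK, cK, t, c, ht.map_mul hφ U he1 hf1 he hf, ht.contr, hc, fun κ _ x ξ => ?_⟩
  have h := le_of_sq_le_sq (hle (∑ j, x j ⊗ₜ[ℂ] ξ j)) (norm_nonneg _)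
  simpa only [htc, map_sum, hm] using h
end

end

/-- Generalized Blecher–Ruan–Sinclair theorem.  Let `X` be a nonzero closed subspace
of `B(H)` and `φ : X × X → X` a bilinear map which is completely contractive in the
Christensen–Sinclair sense.  If there are nets `(e_α)`, `(f_β)` in the unit ball of
`X` with `φ(x, e_α) → x` and `φ(f_β, x) → x` in norm for every `x ∈ X`, then `(X, φ)`
admits a completely isometric multiplicative representation `π` on a Hilbert space
`K`. -/
theorem stmt3 {H : Type u} [NormedAddCommGroup H] [InnerProductSpace ℂ H]
    [CompleteSpace H]
    (X : Submodule ℂ (H →L[ℂ] H)) (hXc : IsClosed (X : Set (H →L[ℂ] H))) (hX0 : X ≠ ⊥)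
    (φ : X →ₗ[ℂ] X →ₗ[ℂ] X)
    (hφcc : ∀ (n : ℕ) (a b : Matrix (Fin n) (Fin n) X),
      cstarMatrixNorm (Matrix.of fun i j => ((∑ k, φ (a i k) (b k j) : X) : H →L[ℂ] H)) ≤
        cstarMatrixNorm (a.map (fun x => (x : H →L[ℂ] H))) *
          cstarMatrixNorm (b.map (fun x => (x : H →L[ℂ] H))))
    {ι κ : Type*} [Preorder ι] [IsDirected ι (· ≤ ·)] [Nonempty ι]
    [Preorder κ] [IsDirected κ (· ≤ ·)] [Nonempty κ]
    (e : ι → X) (f : κ → X)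
    (he1 : ∀ α, ‖(e α : H →L[ℂ] H)‖ ≤ 1) (hf1 : ∀ β, ‖(f β : H →L[ℂ] H)‖ ≤ 1)
    (he : ∀ x : X, Filter.Tendsto (fun α => ((φ x (e α) : X) : H →L[ℂ] H))
      Filter.atTop (nhds (x : H →L[ℂ] H)))
    (hf : ∀ x : X, Filter.Tendsto (fun β => ((φ (f β) x : X) : H →L[ℂ] H))
      Filter.atTop (nhds (x : H →L[ℂ] H))) :
    ∃ (K : Type u) (nK : NormedAddCommGroup K),
      letI := nK
      ∃ iK : InnerProductSpace ℂ K,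
        letI := iK
        ∃ cK : CompleteSpace K,
        letI := cK
        ∃ π : X →ₗ[ℂ] (K →L[ℂ] K),
          (∀ x y : X, π (φ x y) = π x * π y) ∧
          (∀ (n : ℕ) (M : Matrix (Fin n) (Fin n) X),
            cstarMatrixNorm (M.map (fun x => π x)) =
              cstarMatrixNorm (M.map (fun x => (x : H →L[ℂ] H)))) := by
  have hf' : ∀ x : X, Filter.Tendsto (fun β => φ (f β) x) Filter.atTop (nhds x) := fun x =>
    tendsto_subtype_rng.2 (hf x)
  have he' : ∀ x : X, Filter.Tendsto (fun α => φ x (e α))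
      (Ultrafilter.of (Filter.atTop : Filter ι)) (nhds x) := fun x =>
    (tendsto_subtype_rng.2 (he x)).mono_left (Ultrafilter.of_le _)
  have hφ : LeftContractive φ := leftContractive_of_tendsto hφcc hf1 hf'
  obtain ⟨K, nK, iK, cK, t, c, hmul, ht, hc, hle⟩ :=
    hφ.exists_multiplicative_rep (Ultrafilter.of Filter.atTop) he1 hf1 he' hf'
  refine ⟨K, nK, iK, cK, t, hmul, fun n M => le_antisymm ?_ ?_⟩
  · refine le_of_forall_gt_imp_ge_of_dense fun r hr => ?_
    have hr0 : 0 < r := (Real.sqrt_nonneg _).trans_lt hr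
    refine (cstarMatrixNorm_le_iff hr0.le).2 (sum_norm_sq_le_of_contr hr0.ne' ?_)
    have hM : MContr (Matrix.of fun i j => (r : ℂ)⁻¹ • M i j) := fun ξ => by
      have h := (cstarMatrixNorm_le_iff hr0.le).1 hr.le ξ
      simp only [Matrix.of_apply, Submodule.coe_smul, smul_apply, ← Finset.smul_sum, norm_smul,
        mul_pow, norm_inv, Complex.norm_real, Real.norm_eq_abs, inv_pow, sq_abs, ← Finset.mul_sum]
      rwa [inv_mul_le_iff₀ (by positivity)]
    simpa only [Matrix.of_apply, Matrix.map_apply, map_smul] using ht _ _ _ hM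
  · refine (cstarMatrixNorm_le_iff (Real.sqrt_nonneg _)).2 fun ξ => ?_
    have h := (cstarMatrixNorm_le_iff (M := M.map fun x => t x) (Real.sqrt_nonneg _)).1 le_rfl
      fun j => c (ξ j)
    refine le_trans (Finset.sum_le_sum fun i _ => ?_) (h.trans (mul_le_mul_of_nonneg_left
      (Finset.sum_le_sum fun j _ => pow_le_pow_left₀ (norm_nonneg _) (hc _) 2) (sq_nonneg _)))
    exact pow_le_pow_left₀ (norm_nonneg _) (hle _ (M i) ξ) 2
end

section
/- Let H be a complex Hilbert space, X a nonzero closed linear subspace of B(H), and φ : X × X → X a bilinear map that is completely contractive in the Christensen–Sinclair sense: for every n ∈ ℕ and all n×n matrices a = (a_{ij}) and b = (b_{ij}) with entries in X, ‖(∑_k φ(a_{ik}, b_{kj}))_{ij}‖ ≤ ‖a‖·‖b‖ in Mₙ(B(H)). Suppose there exist nets (e_α) and (f_β) in X with ‖e_α‖ ≤ 1 and ‖f_β‖ ≤ 1 for all indices, such that φ(x, e_α) → x and φ(f_β, x) → x in norm for every x ∈ X. Then φ is associative: φ(φ(x, y), w) = φ(x, φ(y, w)) for all x, y, w ∈ X.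 -/
open scoped Matrix

namespace ChristensenSinclair

open Filter Topology
open scoped TensorProduct ComplexConjugate

universe u

section Bridge

variable {H : Type*} [NormedAddCommGroup H] [InnerProductSpace ℂ H]

/-- The operator on `H^n` given by a matrix of operators on `H`. -/
noncomputable def matrixOp {n : ℕ} (M : Matrix (Fin n) (Fin n) (H →L[ℂ] H)) :
    PiLp 2 (fun _ : Fin n => H) →L[ℂ] PiLp 2 (fun _ : Fin n => H) :=
  (PiLp.continuousLinearEquiv 2 ℂ (fun _ : Fin n => H)).symm.toContinuousLinearMap ∘L
    (ContinuousLinearMap.pi fun i => ∑ j, (M i j) ∘L ContinuousLinearMap.proj j) ∘L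
    (PiLp.continuousLinearEquiv 2 ℂ (fun _ : Fin n => H)).toContinuousLinearMap

lemma matrixOp_apply {n : ℕ} (M : Matrix (Fin n) (Fin n) (H →L[ℂ] H))
    (v : PiLp 2 (fun _ : Fin n => H)) (i : Fin n) :
    matrixOp M v i = ∑ j, M i j (v j) := by
  simp [matrixOp]

/-- `matrixOp` as an algebra homomorphism. -/
noncomputable def matrixOpHom (n : ℕ) :
    Matrix (Fin n) (Fin n) (H →L[ℂ] H) →ₐ[ℂ]
      (PiLp 2 (fun _ : Fin n => H) →L[ℂ] PiLp 2 (fun _ : Fin n => H)) :=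
  AlgHom.ofLinearMap
    { toFun := matrixOp
      map_add' := fun M N => by
        ext v i; simp [matrixOp_apply, Finset.sum_add_distrib]
      map_smul' := fun c M => by
        ext v i; simp [matrixOp_apply, Finset.smul_sum] }
    (by
      ext v i
      have h : ∀ j, (if i = j then (1 : H →L[ℂ] H) else 0) (v j) = if i = j then v j else 0 :=
        fun j => by split_ifs <;> simp
      simp [matrixOp_apply, Matrix.one_apply, h])
    (by
      intro M N
      ext v i
      change matrixOp (M * N) v i = matrixOp M (matrixOp N v) i
      simp only [matrixOp_apply, Matrix.mul_apply, sum_apply, map_sum]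
      exact Finset.sum_comm)

lemma matrixOpHom_apply {n : ℕ} (M : Matrix (Fin n) (Fin n) (H →L[ℂ] H)) :
    matrixOpHom n M = matrixOp M := rfl

lemma matrixOpHom_bijective (n : ℕ) : Function.Bijective (matrixOpHom (H := H) n) := by
  constructor
  · rw [injective_iff_map_eq_zero]
    intro M hM
    ext i j x
    have h := congrArg (fun T => T (WithLp.toLp 2 (Pi.single j x)) i) hM
    simp only [matrixOpHom_apply, matrixOp_apply] at h
    rw [Finset.sum_eq_single j] at h
    · simpa using h
    · intro k _ hk
      simp [hk]
    · simp
  · intro T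
    refine ⟨Matrix.of fun i j => (ContinuousLinearMap.proj i) ∘L
      (PiLp.continuousLinearEquiv 2 ℂ (fun _ : Fin n => H)).toContinuousLinearMap ∘L T ∘L
      (PiLp.continuousLinearEquiv 2 ℂ (fun _ : Fin n => H)).symm.toContinuousLinearMap ∘L
      (ContinuousLinearMap.single ℂ (fun _ : Fin n => H) j), ?_⟩
    ext v i
    have hv : v = ∑ j, WithLp.toLp 2 (Pi.single j (v j)) := by
      ext k
      simp [Finset.sum_apply, Pi.single_apply]
    conv_rhs => rw [hv, map_sum]
    simp [matrixOpHom_apply, matrixOp_apply]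

variable [CompleteSpace H]

lemma matrixOp_star {n : ℕ} (M : Matrix (Fin n) (Fin n) (H →L[ℂ] H)) :
    matrixOp (star M) = star (matrixOp M) := by
  rw [ContinuousLinearMap.star_eq_adjoint, ContinuousLinearMap.eq_adjoint_iff]
  intro v w
  simp only [PiLp.inner_apply, matrixOp_apply, sum_inner, inner_sum]
  rw [Finset.sum_comm]
  refine Finset.sum_congr rfl fun i _ => Finset.sum_congr rfl fun j _ => ?_
  simp [Matrix.star_apply, ContinuousLinearMap.star_eq_adjoint,
    ContinuousLinearMap.adjoint_inner_left]

lemma cstarMatrixNorm_eq {n : ℕ} (M : Matrix (Fin n) (Fin n) (H →L[ℂ] H)) :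
    cstarMatrixNorm M = ‖matrixOp M‖ := by
  have h1 : spectralRadius ℂ (star M * M) = spectralRadius ℂ (star (matrixOp M) * matrixOp M) := by
    have := AlgEquiv.spectrum_eq (AlgEquiv.ofBijective (matrixOpHom (H := H) n)
      (matrixOpHom_bijective n)) (star M * M)
    simp only [AlgEquiv.coe_ofBijective, map_mul, matrixOpHom_apply, matrixOp_star] at this
    rw [spectralRadius, spectralRadius, this]
  rw [cstarMatrixNorm, h1, (IsSelfAdjoint.star_mul_self _).spectralRadius_eq_nnnorm]
  simp [CStarRing.norm_star_mul_self]

end Bridge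

section MatContr

variable {X : Type*} [AddCommGroup X] [Module ℂ X]
variable {K L : Type*} [NormedAddCommGroup K] [InnerProductSpace ℂ K]
  [NormedAddCommGroup L] [InnerProductSpace ℂ L]
variable {ι κ μ ν : Type*} [Fintype ι] [Fintype κ] [Fintype μ] [Fintype ν]

/-- The matrix `a` over `X` acts contractively from `K^κ` to `L^ι` through `D`. -/
def MatContr (D : X →ₗ[ℂ] K →L[ℂ] L) (a : Matrix ι κ X) : Prop :=
  ∀ u : κ → K, ∑ i, ‖∑ k, D (a i k) (u k)‖ ^ 2 ≤ ∑ k, ‖u k‖ ^ 2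

/-- The matrix product along the bilinear map `φ`. -/
def bilinMul (φ : X →ₗ[ℂ] X →ₗ[ℂ] X) (a : Matrix ι κ X) (b : Matrix κ μ X) : Matrix ι μ X :=
  Matrix.of fun i l => ∑ k, φ (a i k) (b k l)

lemma MatContr.submatrix {D : X →ₗ[ℂ] K →L[ℂ] L} {a : Matrix ι κ X} (h : MatContr D a)
    (r : μ ≃ ι) (s : ν ≃ κ) : MatContr D (a.submatrix r s) := by
  intro u
  have := h (u ∘ s.symm)
  rw [← r.sum_comp, ← s.sum_comp (fun k => ‖(u ∘ s.symm) k‖ ^ 2)] at this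
  simp_rw [← s.sum_comp (fun k => D (a _ k) ((u ∘ s.symm) k))] at this
  simpa using this

end MatContr

section Bridge

variable {H : Type*} [NormedAddCommGroup H] [InnerProductSpace ℂ H] [CompleteSpace H]
variable {X : Submodule ℂ (H →L[ℂ] H)}

lemma matContr_subtype_iff {n : ℕ} (a : Matrix (Fin n) (Fin n) X) :
    MatContr X.subtype a ↔ cstarMatrixNorm (a.map (fun x => (x : H →L[ℂ] H))) ≤ 1 := by
  rw [cstarMatrixNorm_eq, ContinuousLinearMap.opNorm_le_iff zero_le_one]
  constructor
  · intro h v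
    rw [one_mul]
    refine le_of_sq_le_sq ?_ (norm_nonneg _)
    rw [PiLp.norm_sq_eq_of_L2, PiLp.norm_sq_eq_of_L2]
    simpa [matrixOp_apply] using h v
  · intro h u
    have := pow_le_pow_left₀ (norm_nonneg _) (h (WithLp.toLp 2 u)) 2
    rw [one_mul, PiLp.norm_sq_eq_of_L2, PiLp.norm_sq_eq_of_L2] at this
    simpa [matrixOp_apply] using this

lemma MatContr.bilinMul {φ : X →ₗ[ℂ] X →ₗ[ℂ] X}
    (hφcc : ∀ (n : ℕ) (a b : Matrix (Fin n) (Fin n) X),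
      cstarMatrixNorm (Matrix.of fun i j => ((∑ k, φ (a i k) (b k j) : X) : H →L[ℂ] H)) ≤
        cstarMatrixNorm (a.map (fun x => (x : H →L[ℂ] H))) *
          cstarMatrixNorm (b.map (fun x => (x : H →L[ℂ] H))))
    {ι κ μ : Type*} [Fintype ι] [Fintype κ] [Fintype μ] {a : Matrix ι κ X} {b : Matrix κ μ X}
    (ha : MatContr X.subtype a) (hb : MatContr X.subtype b) :
    MatContr X.subtype (bilinMul φ a b) := by
  classical
  let a' : Matrix (ι ⊕ κ ⊕ μ) (ι ⊕ κ ⊕ μ) X :=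
    Matrix.of (Sum.elim (fun i => Sum.elim 0 (Sum.elim (fun k => a i k) 0)) 0)
  let b' : Matrix (ι ⊕ κ ⊕ μ) (ι ⊕ κ ⊕ μ) X :=
    Matrix.of (Sum.elim 0 (Sum.elim (fun k => Sum.elim 0 (Sum.elim 0 (fun l => b k l))) 0))
  have ha' : MatContr X.subtype a' := by
    intro u
    have := ha fun k => u (.inr (.inl k))
    simp only [Fintype.sum_sum_type]
    simp [a'] at this ⊢
    nlinarith [Finset.sum_nonneg fun i (_ : i ∈ Finset.univ) => sq_nonneg ‖u (.inl i)‖,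
      Finset.sum_nonneg fun i (_ : i ∈ Finset.univ) => sq_nonneg ‖u (.inr (.inr i))‖]
  have hb' : MatContr X.subtype b' := by
    intro u
    have := hb fun k => u (.inr (.inr k))
    simp only [Fintype.sum_sum_type]
    simp [b'] at this ⊢
    nlinarith [Finset.sum_nonneg fun i (_ : i ∈ Finset.univ) => sq_nonneg ‖u (.inl i)‖,
      Finset.sum_nonneg fun i (_ : i ∈ Finset.univ) => sq_nonneg ‖u (.inr (.inl i))‖]
  let e := Fintype.equivFin (ι ⊕ κ ⊕ μ)
  have key : MatContr X.subtype (ChristensenSinclair.bilinMul φ (a'.submatrix e.symm e.symm)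
      (b'.submatrix e.symm e.symm)) := by
    rw [matContr_subtype_iff]
    refine (hφcc _ _ _).trans (mul_le_one₀ ?_ (Real.sqrt_nonneg _) ?_)
    · exact (matContr_subtype_iff _).1 (ha'.submatrix _ _)
    · exact (matContr_subtype_iff _).1 (hb'.submatrix _ _)
  have key2 := key.submatrix e e
  intro u
  have := key2 (Sum.elim 0 (Sum.elim 0 u))
  simp only [Fintype.sum_sum_type, ChristensenSinclair.bilinMul, Matrix.submatrix_apply,
    Matrix.of_apply, ← e.sum_comp, Equiv.symm_apply_apply] at this
  simpa [a', b', ChristensenSinclair.bilinMul] using this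

end Bridge

section ScalContr

variable {ι κ : Type*} [Fintype ι] [Fintype κ]

/-- The scalar matrix `g` is a contraction from `ℓ²(κ)` to `ℓ²(ι)`. -/
def ScalContr (g : Matrix ι κ ℂ) : Prop :=
  ∀ v : κ → ℂ, ∑ i, ‖∑ k, g i k * v k‖ ^ 2 ≤ ∑ k, ‖v k‖ ^ 2

lemma ScalContr.sum_norm_sq_le {g : Matrix ι κ ℂ} (hg : ScalContr g)
    {V : Type*} [NormedAddCommGroup V] [InnerProductSpace ℂ V] (z : κ → V) :
    ∑ i, ‖∑ k, g i k • z k‖ ^ 2 ≤ ∑ k, ‖z k‖ ^ 2 := by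
  let W := Submodule.span ℂ (Set.range z)
  have : FiniteDimensional ℂ W := FiniteDimensional.span_of_finite ℂ (Set.finite_range z)
  let b := stdOrthonormalBasis ℂ W
  let z' : κ → W := fun k => ⟨z k, Submodule.subset_span ⟨k, rfl⟩⟩
  have h : ∑ i, ‖∑ k, g i k • z' k‖ ^ 2 ≤ ∑ k, ‖z' k‖ ^ 2 := by
    simp_rw [← b.sum_sq_norm_inner_right]
    rw [Finset.sum_comm, Finset.sum_comm (s := Finset.univ (α := κ))]
    refine Finset.sum_le_sum fun m _ => ?_
    simpa [inner_sum, inner_smul_right] using hg fun k => inner ℂ (b m) (z' k)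
  have e1 : ∀ i, ‖∑ k, g i k • z k‖ = ‖∑ k, g i k • z' k‖ := fun i => by
    simp [z']
  simp_rw [e1]
  exact h

/-- A version of the Douglas lemma: a family of functionals dominated, in the sense of sums of
squares, by another one is obtained from it by a scalar contraction. -/
lemma exists_scalContr_of_sum_eq {F : Type*} [AddCommGroup F] [Module ℂ F]
    (w : κ → F) (y : ι → F)
    (h : ∀ f : Module.Dual ℂ F, ∑ k, ‖f (w k)‖ ^ 2 = ∑ i, ‖f (y i)‖ ^ 2) :
    ∃ g : Matrix ι κ ℂ, ScalContr g ∧ ∀ i, y i = ∑ k, g i k • w k := by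
  classical
  let A : Module.Dual ℂ F →ₗ[ℂ] EuclideanSpace ℂ κ :=
    (WithLp.linearEquiv 2 ℂ (κ → ℂ)).symm.toLinearMap ∘ₗ
      LinearMap.pi fun k => Module.Dual.eval ℂ F (w k)
  let B : Module.Dual ℂ F →ₗ[ℂ] (ι → ℂ) := LinearMap.pi fun i => Module.Dual.eval ℂ F (y i)
  have hA : ∀ f k, A f k = f (w k) := fun f k => rfl
  have hB : ∀ f i, B f i = f (y i) := fun f i => rfl
  have hAB : ∀ f, ‖A f‖ ^ 2 = ∑ i, ‖B f i‖ ^ 2 := fun f => by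
    rw [EuclideanSpace.norm_sq_eq]; exact h f
  obtain ⟨s, hs⟩ := LinearMap.exists_rightInverse_of_surjective A.rangeRestrict
    A.range_rangeRestrict
  have hs' : ∀ r, A (s r) = r := fun r => congrArg Subtype.val (LinearMap.congr_fun hs r)
  let G : EuclideanSpace ℂ κ →ₗ[ℂ] (ι → ℂ) :=
    B ∘ₗ s ∘ₗ (LinearMap.range A).orthogonalProjectionOnto.toLinearMap
  have hG : ∀ v i, ∑ k, G (EuclideanSpace.single k 1) i * v k = G v i := by
    intro v i
    have hv : v = ∑ k, v k • EuclideanSpace.single k (1 : ℂ) := by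
      ext l
      simp [Pi.single_apply]
    conv_rhs => rw [hv, map_sum]
    simp [mul_comm]
  refine ⟨Matrix.of fun i k => G (EuclideanSpace.single k 1) i, ?_, ?_⟩
  · intro v
    have h1 := hG (WithLp.toLp 2 v)
    simp only [Matrix.of_apply] at h1 ⊢
    simp_rw [h1]
    refine (hAB _).symm.le.trans ?_
    change ‖A (s _)‖ ^ 2 ≤ _
    rw [hs']
    refine (pow_le_pow_left₀ (norm_nonneg _)
      ((LinearMap.range A).norm_orthogonalProjectionOnto_apply_le (WithLp.toLp 2 v)) 2).trans ?_
    rw [EuclideanSpace.norm_sq_eq]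
  · intro i
    rw [← sub_eq_zero, ← Module.forall_dual_apply_eq_zero_iff ℂ]
    intro f
    have hP : (LinearMap.range A).orthogonalProjectionOnto (A f) = ⟨A f, f, rfl⟩ :=
      (LinearMap.range A).orthogonalProjectionOnto_mem_subspace_eq_self ⟨A f, f, rfl⟩
    have h0 : A (s ⟨A f, f, rfl⟩ - f) = 0 := by rw [map_sub, hs', sub_self]
    have h1 := hAB (s ⟨A f, f, rfl⟩ - f)
    rw [h0, norm_zero, zero_pow two_ne_zero, eq_comm,
      Finset.sum_eq_zero_iff_of_nonneg fun i _ => sq_nonneg _] at h1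
    have h2 := h1 i (Finset.mem_univ _)
    have h3 : G (A f) i = f (y i) := by
      simp only [G, LinearMap.comp_apply, ContinuousLinearMap.coe_coe, hP, ← hB]
      rw [map_sub] at h2
      simpa [sub_eq_zero] using h2
    have h4 := hG (A f) i
    rw [h3] at h4
    simp [← h4, hA]

end ScalContr

section MatContr

variable {X : Type*} [AddCommGroup X] [Module ℂ X]
variable {K L : Type*} [NormedAddCommGroup K] [InnerProductSpace ℂ K]
  [NormedAddCommGroup L] [InnerProductSpace ℂ L]
variable {ι κ μ ν : Type*} [Fintype ι] [Fintype κ] [Fintype μ] [Fintype ν]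
variable {D : X →ₗ[ℂ] K →L[ℂ] L}

lemma MatContr.scalar_mul {g : Matrix ι μ ℂ} (hg : ScalContr g) {a : Matrix μ κ X}
    (ha : MatContr D a) : MatContr D (Matrix.of fun i k => ∑ l, g i l • a l k) := by
  intro u
  refine le_trans (le_of_eq ?_) ((hg.sum_norm_sq_le fun l => ∑ k, D (a l k) (u k)).trans (ha u))
  refine Finset.sum_congr rfl fun i _ => ?_
  simp only [Matrix.of_apply, map_sum, map_smul, sum_apply, smul_apply, Finset.smul_sum]
  rw [Finset.sum_comm]

lemma MatContr.fromBlocks {a : Matrix ι κ X} {b : Matrix μ ν X} (ha : MatContr D a)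
    (hb : MatContr D b) : MatContr D (Matrix.fromBlocks a 0 0 b) := by
  intro u
  have h1 := ha fun k => u (.inl k)
  have h2 := hb fun k => u (.inr k)
  simpa [Fintype.sum_sum_type] using add_le_add h1 h2

lemma matContr_unit_iff {x : X} :
    MatContr D (Matrix.of fun (_ _ : Unit) => x) ↔ ‖D x‖ ≤ 1 := by
  rw [ContinuousLinearMap.opNorm_le_iff zero_le_one]
  simp only [MatContr, one_mul]
  constructor
  · intro h v
    have := h fun _ => v
    refine le_of_sq_le_sq ?_ (norm_nonneg _)
    simpa using this
  · intro h v
    simpa using pow_le_pow_left₀ (norm_nonneg _) (h (v ())) 2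

lemma matContr_zero : MatContr D (0 : Matrix ι κ X) := by
  intro u
  simpa using Finset.sum_nonneg fun i _ => sq_nonneg ‖u i‖

end MatContr

section CompletelyContractive

variable {X : Type*} [AddCommGroup X] [Module ℂ X]
variable {H : Type*} [NormedAddCommGroup H] [InnerProductSpace ℂ H]
variable {K L : Type*} [NormedAddCommGroup K] [InnerProductSpace ℂ K]
  [NormedAddCommGroup L] [InnerProductSpace ℂ L]

/-- The map `D` is completely contractive for the matrix norms induced by `j`. -/
def CompContr (j : X →ₗ[ℂ] H →L[ℂ] H) (D : X →ₗ[ℂ] K →L[ℂ] L) : Prop :=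
  ∀ (ι κ : Type) [Fintype ι] [Fintype κ] (a : Matrix ι κ X), MatContr j a → MatContr D a

/-- Products along `φ` of contractive matrices are contractive. -/
def MulContr (j : X →ₗ[ℂ] H →L[ℂ] H) (φ : X →ₗ[ℂ] X →ₗ[ℂ] X) : Prop :=
  ∀ (ι κ μ : Type) [Fintype ι] [Fintype κ] [Fintype μ] (a : Matrix ι κ X) (b : Matrix κ μ X),
    MatContr j a → MatContr j b → MatContr j (bilinMul φ a b)

lemma CompContr.norm_le {j : X →ₗ[ℂ] H →L[ℂ] H} {D : X →ₗ[ℂ] K →L[ℂ] L} (h : CompContr j D)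
    (x : X) : ‖D x‖ ≤ ‖j x‖ := by
  refine le_of_forall_pos_le_add fun ε hε => ?_
  have hp : 0 < ‖j x‖ + ε := by positivity
  have h1 : ‖D (((‖j x‖ + ε)⁻¹ : ℂ) • x)‖ ≤ 1 := by
    rw [← matContr_unit_iff]
    refine h _ _ _ ?_
    rw [matContr_unit_iff, map_smul, norm_smul, norm_inv, ← Complex.ofReal_add,
      Complex.norm_of_nonneg hp.le]
    exact (inv_mul_le_one₀ hp).2 (by linarith)
  rw [map_smul, norm_smul, norm_inv, ← Complex.ofReal_add,
      Complex.norm_of_nonneg hp.le] at h1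
  exact (inv_mul_le_one₀ hp).1 h1

/-- The family `w` in `X ⊗ K` is represented as `a ⊙ u` with `a` a contractive matrix over `X`
and `u` a column in `K` with `‖u‖² ≤ t`. -/
def PB (j : X →ₗ[ℂ] H →L[ℂ] H) {ι : Type} [Fintype ι] (w : ι → X ⊗[ℂ] K) (t : ℝ) : Prop :=
  ∃ (κ : Type) (_ : Fintype κ) (a : Matrix ι κ X) (u : κ → K), MatContr j a ∧
    (∀ i, w i = ∑ k, a i k ⊗ₜ[ℂ] u k) ∧ ∑ k, ‖u k‖ ^ 2 ≤ t

/-- The action of a matrix over `X` on a column in `X ⊗ K`. -/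
noncomputable def matAct (φ : X →ₗ[ℂ] X →ₗ[ℂ] X) {ι κ : Type} [Fintype κ] (b : Matrix ι κ X)
    (w : κ → X ⊗[ℂ] K) (i : ι) : X ⊗[ℂ] K :=
  ∑ k, (φ (b i k)).rTensor K (w k)

section PB

variable {j : X →ₗ[ℂ] H →L[ℂ] H} {ι κ : Type} [Fintype ι] [Fintype κ]
  {w : ι → X ⊗[ℂ] K} {v : κ → X ⊗[ℂ] K} {s t : ℝ}

lemma PB.sumElim (h : PB j w t) (h' : PB j v s) : PB j (Sum.elim w v) (t + s) := by
  obtain ⟨μ, _, a, u, ha, hw, hu⟩ := h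
  obtain ⟨ν, _, b, z, hb, hv, hz⟩ := h'
  refine ⟨μ ⊕ ν, inferInstance, Matrix.fromBlocks a 0 0 b, Sum.elim u z, ha.fromBlocks hb,
    ?_, ?_⟩
  · rintro (i | i) <;> simp [hw, hv]
  · simpa using add_le_add hu hz

lemma PB.smul (h : PB j w t) {c : ℂ} : PB j (fun i => c • w i) (‖c‖ ^ 2 * t) := by
  obtain ⟨μ, _, a, u, ha, hw, hu⟩ := h
  refine ⟨μ, inferInstance, a, fun k => c • u k, ha, ?_, ?_⟩
  · intro i
    simp [hw, Finset.smul_sum]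
  · simp_rw [norm_smul, mul_pow, ← Finset.mul_sum]
    gcongr

lemma PB.scalar_mul (h : PB j w t) {g : Matrix κ ι ℂ} (hg : ScalContr g) :
    PB j (fun i => ∑ k, g i k • w k) t := by
  obtain ⟨μ, _, a, u, ha, hw, hu⟩ := h
  refine ⟨μ, inferInstance, _, u, ha.scalar_mul hg, ?_, hu⟩
  intro i
  simp only [hw, Finset.smul_sum, Matrix.of_apply, TensorProduct.sum_tmul, TensorProduct.smul_tmul']
  rw [Finset.sum_comm]

lemma PB.matAct {φ : X →ₗ[ℂ] X →ₗ[ℂ] X} (hφ : MulContr j φ) (h : PB j w t) {b : Matrix κ ι X}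
    (hb : MatContr j b) : PB j (matAct φ b w) t := by
  obtain ⟨μ, _, a, u, ha, hw, hu⟩ := h
  refine ⟨μ, inferInstance, _, u, hφ _ _ _ _ _ hb ha, ?_, hu⟩
  intro i
  simp only [ChristensenSinclair.matAct, hw, map_sum, LinearMap.rTensor_tmul, bilinMul,
    Matrix.of_apply, TensorProduct.sum_tmul]
  rw [Finset.sum_comm]

lemma exists_pb (x : X ⊗[ℂ] K) : ∃ t, PB j (fun _ : Unit => x) t := by
  induction x using TensorProduct.induction_on with
  | zero => exact ⟨0, Unit, inferInstance, 0, 0, matContr_zero, by simp, by simp⟩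
  | tmul x u =>
    have hp : 0 < ‖j x‖ + 1 := by positivity
    let c : ℂ := ((‖j x‖ + 1 : ℝ) : ℂ)
    have hc : c ≠ 0 := Complex.ofReal_ne_zero.2 hp.ne'
    refine ⟨_, Unit, inferInstance, Matrix.of fun _ _ => c⁻¹ • x, fun _ => c • u, ?_, ?_, le_rfl⟩
    · rw [matContr_unit_iff, map_smul, norm_smul, norm_inv, Complex.norm_of_nonneg hp.le]
      exact (inv_mul_le_one₀ hp).2 (by linarith)
    · intro _
      simp [TensorProduct.smul_tmul, smul_smul, hc]
  | add x y hx hy =>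
    obtain ⟨s, hs⟩ := hx
    obtain ⟨t, ht⟩ := hy
    let g : Matrix Unit (Unit ⊕ Unit) ℂ := Matrix.of fun _ _ => 2⁻¹
    have hg : ScalContr g := by
      intro v
      simp only [Fintype.sum_sum_type, g, Matrix.of_apply, Finset.univ_unique,
        Finset.sum_singleton, ← mul_add, norm_mul, norm_inv, Complex.norm_ofNat]
      have := norm_add_le (v (.inl ())) (v (.inr ()))
      have h2 := sq_nonneg (‖v (.inl ())‖ - ‖v (.inr ())‖)
      have h3 := norm_nonneg (v (.inl ()) + v (.inr ()))
      simp only [PUnit.default_eq_unit]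
      nlinarith
    have := ((hs.sumElim ht).smul (c := 2)).scalar_mul hg
    refine ⟨‖(2 : ℂ)‖ ^ 2 * (s + t), ?_⟩
    convert this using 2
    simp [g, smul_smul]

end PB

end CompletelyContractive

section Sandwich

variable {X : Type*} [AddCommGroup X] [Module ℂ X]
variable {H : Type*} [NormedAddCommGroup H] [InnerProductSpace ℂ H]
variable {K : Type*} [NormedAddCommGroup K] [InnerProductSpace ℂ K]

/-- A positive semidefinite form on `X ⊗ K` dominated by the matrix norm structure. -/
def Admissible (j : X →ₗ[ℂ] H →L[ℂ] H) (q : PreInnerProductSpace.Core ℂ (X ⊗[ℂ] K)) : Prop :=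
  ∀ (ι : Type) [Fintype ι] (w : ι → X ⊗[ℂ] K) (t : ℝ), PB j w t →
    ∑ i, (q.inner (w i) (w i)).re ≤ t

/-- The family `y` can be moved by a contractive matrix to a family with `q`-energy at least
`r`. -/
def LB (j : X →ₗ[ℂ] H →L[ℂ] H) (φ : X →ₗ[ℂ] X →ₗ[ℂ] X)
    (q : PreInnerProductSpace.Core ℂ (X ⊗[ℂ] K)) {κ : Type} [Fintype κ]
    (y : κ → X ⊗[ℂ] K) (r : ℝ) : Prop :=
  ∃ (ι : Type) (_ : Fintype ι) (b : Matrix ι κ X), MatContr j b ∧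
    r ≤ ∑ i, (q.inner (matAct φ b y i) (matAct φ b y i)).re

variable {j : X →ₗ[ℂ] H →L[ℂ] H} {φ : X →ₗ[ℂ] X →ₗ[ℂ] X}
  {q : PreInnerProductSpace.Core ℂ (X ⊗[ℂ] K)}

lemma core_inner_smul_smul {F : Type*} [AddCommGroup F] [Module ℂ F]
    (q : PreInnerProductSpace.Core ℂ F) (c : ℂ) (x : F) :
    (q.inner (c • x) (c • x)).re = ‖c‖ ^ 2 * (q.inner x x).re := by
  have h1 : q.inner (c • x) (c • x) = conj c * q.inner x (c • x) := q.smul_left _ _ _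
  have h2 : q.inner x (c • x) = c * q.inner x x := by
    rw [← q.conj_inner_symm, q.smul_left, map_mul, q.conj_inner_symm, Complex.conj_conj]
  rw [h1, h2, ← mul_assoc, Complex.conj_mul', ← Complex.ofReal_pow, Complex.re_ofReal_mul]

lemma lb_zero {κ : Type} [Fintype κ] (y : κ → X ⊗[ℂ] K) : LB j φ q y 0 :=
  ⟨Unit, inferInstance, 0, matContr_zero, Finset.sum_nonneg fun _ _ => q.re_inner_nonneg _⟩

lemma LB.sumElim {κ μ : Type} [Fintype κ] [Fintype μ] {y : κ → X ⊗[ℂ] K} {z : μ → X ⊗[ℂ] K}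
    {r s : ℝ} (hy : LB j φ q y r) (hz : LB j φ q z s) : LB j φ q (Sum.elim y z) (r + s) := by
  obtain ⟨ι, _, b, hb, hr⟩ := hy
  obtain ⟨ν, _, c, hc, hs⟩ := hz
  refine ⟨ι ⊕ ν, inferInstance, Matrix.fromBlocks b 0 0 c, hb.fromBlocks hc, ?_⟩
  simpa [matAct] using add_le_add hr hs

lemma LB.smul {κ : Type} [Fintype κ] {y : κ → X ⊗[ℂ] K} {r : ℝ} (hy : LB j φ q y r) (c : ℂ) :
    LB j φ q (fun k => c • y k) (‖c‖ ^ 2 * r) := by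
  obtain ⟨ι, _, b, hb, hr⟩ := hy
  refine ⟨ι, inferInstance, b, hb, ?_⟩
  have : ∀ i, matAct φ b (fun k => c • y k) i = c • matAct φ b y i := fun i => by
    simp [matAct, Finset.smul_sum]
  simp_rw [this, core_inner_smul_smul, ← Finset.mul_sum]
  gcongr

/-- Evaluation of a formal combination of pairs on a rank one form. -/
noncomputable def evForm {F : Type*} [AddCommGroup F] [Module ℂ F] (f : Module.Dual ℂ F) :
    (F × F →₀ ℂ) →ₗ[ℂ] ℂ :=
  Finsupp.linearCombination ℂ fun p => conj (f p.1) * f p.2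

lemma evForm_single {F : Type*} [AddCommGroup F] [Module ℂ F] (f : Module.Dual ℂ F) (x y : F)
    (c : ℂ) : evForm f (Finsupp.single (x, y) c) = c * (conj (f x) * f y) := by
  simp [evForm]

lemma evForm_single_self {F : Type*} [AddCommGroup F] [Module ℂ F] (f : Module.Dual ℂ F) (x : F) :
    (evForm f (Finsupp.single (x, x) 1)).re = ‖f x‖ ^ 2 := by
  rw [evForm_single, one_mul, Complex.conj_mul', ← Complex.ofReal_pow, Complex.ofReal_re]

/-- The cone of formal inequalities satisfied by an intermediate form. -/
def formCone (j : X →ₗ[ℂ] H →L[ℂ] H) (φ : X →ₗ[ℂ] X →ₗ[ℂ] X)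
    (q : PreInnerProductSpace.Core ℂ (X ⊗[ℂ] K)) :
    PointedCone ℝ (((X ⊗[ℂ] K) × (X ⊗[ℂ] K) →₀ ℂ) × ℝ) where
  carrier := {p | ∃ (ι κ : Type) (_ : Fintype ι) (_ : Fintype κ) (w : ι → X ⊗[ℂ] K)
    (y : κ → X ⊗[ℂ] K) (t r : ℝ), PB j w t ∧ LB j φ q y r ∧ t - r ≤ p.2 ∧
      ∀ f, (evForm f p.1).re = ∑ i, ‖f (w i)‖ ^ 2 - ∑ k, ‖f (y k)‖ ^ 2}
  zero_mem' := ⟨Empty, Empty, inferInstance, inferInstance, Empty.elim, Empty.elim, 0, 0,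
    ⟨Empty, inferInstance, 0, 0, matContr_zero, by simp, by simp⟩, lb_zero _, by simp, by simp⟩
  add_mem' := by
    rintro p p' ⟨ι, κ, _, _, w, y, t, r, hw, hy, htr, hf⟩
      ⟨ι', κ', _, _, w', y', t', r', hw', hy', htr', hf'⟩
    refine ⟨_, _, inferInstance, inferInstance, _, _, _, _, hw.sumElim hw', hy.sumElim hy', ?_, ?_⟩
    · simp only [Prod.snd_add]; linarith
    · intro f
      simp only [Prod.fst_add, map_add, Complex.add_re, hf, hf', Fintype.sum_sum_type,
        Sum.elim_inl, Sum.elim_inr]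
      ring
  smul_mem' := by
    rintro ⟨c, hc⟩ p ⟨ι, κ, _, _, w, y, t, r, hw, hy, htr, hf⟩
    have hc' : ‖(Real.sqrt c : ℂ)‖ ^ 2 = c := by
      rw [Complex.norm_of_nonneg (Real.sqrt_nonneg _), Real.sq_sqrt hc]
    refine ⟨_, _, inferInstance, inferInstance, _, _, _, _, hw.smul (c := (Real.sqrt c : ℂ)),
      hy.smul (Real.sqrt c : ℂ), ?_, ?_⟩
    · rw [hc', ← mul_sub]
      exact mul_le_mul_of_nonneg_left htr hc
    · intro f
      have h1 : (⟨c, hc⟩ : NNReal) • p.1 = (c : ℂ) • p.1 := by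
        ext x
        exact Complex.real_smul
      simp only [map_smul, norm_smul, mul_pow, hc', ← Finset.mul_sum, ← mul_sub, ← hf]
      change (evForm f (((⟨c, hc⟩ : NNReal)) • p.1)).re = _
      rw [h1, map_smul, smul_eq_mul, Complex.re_ofReal_mul]

lemma formCone_nonneg (hφ : MulContr j φ) (hq : Admissible j q) {t : ℝ}
    (h : (0, t) ∈ formCone j φ q) : 0 ≤ t := by
  obtain ⟨ι, κ, _, _, w, y, t', r, hw, ⟨ν, _, b, hb, hr⟩, htr, hf⟩ := h
  obtain ⟨g, hg, hy⟩ := exists_scalContr_of_sum_eq w y fun f => by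
    have := hf f
    rw [map_zero, Complex.zero_re] at this
    linarith
  obtain rfl : y = fun i => ∑ k, g i k • w k := funext hy
  have := hq _ _ _ ((hw.scalar_mul hg).matAct hφ hb)
  dsimp only at htr
  linarith

lemma exists_mem_formCone (μ : (X ⊗[ℂ] K) × (X ⊗[ℂ] K) →₀ ℂ) :
    ∃ t, (μ, t) ∈ formCone j φ q := by
  induction μ using Finsupp.induction_linear with
  | zero => exact ⟨0, zero_mem _⟩
  | add μ ν hμ hν =>
    obtain ⟨s, hs⟩ := hμ
    obtain ⟨t, ht⟩ := hν
    exact ⟨s + t, add_mem hs ht⟩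
  | single p c =>
    obtain ⟨x, y⟩ := p
    obtain ⟨t, ht⟩ := exists_pb (j := j) ((2⁻¹ : ℂ) • (x + c • y))
    refine ⟨t, Unit, Unit, inferInstance, inferInstance, _, fun _ => (2⁻¹ : ℂ) • (x - c • y), t, 0,
      ht, lb_zero _, by simp, fun f => ?_⟩
    simp only [evForm_single, map_smul, map_add, map_sub, Finset.univ_unique,
      Finset.sum_singleton, smul_eq_mul, ← Complex.normSq_eq_norm_sq, Complex.normSq_apply]
    simp
    ring

/-- Interpolation: every admissible form is dominated, after any contractive matrix action, by
a single admissible form. -/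
lemma exists_admissible_ge (hφ : MulContr j φ) (hq : Admissible j q) :
    ∃ q' : PreInnerProductSpace.Core ℂ (X ⊗[ℂ] K), Admissible j q' ∧
      ∀ (κ : Type) [Fintype κ] (y : κ → X ⊗[ℂ] K) (r : ℝ), LB j φ q y r →
        r ≤ ∑ k, (q'.inner (y k) (y k)).re := by
  let C := formCone (K := K) j φ q
  let E := (((X ⊗[ℂ] K) × (X ⊗[ℂ] K) →₀ ℂ) × ℝ)
  let f0 : E →ₗ.[ℝ] ℝ :=
    { domain := LinearMap.range (LinearMap.inr ℝ ((X ⊗[ℂ] K) × (X ⊗[ℂ] K) →₀ ℂ) ℝ)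
      toFun := LinearMap.snd ℝ _ _ ∘ₗ Submodule.subtype _ }
  obtain ⟨g, hg0, hgC⟩ := riesz_extension C f0
    (by
      rintro ⟨_, ⟨t, rfl⟩⟩ hx
      exact formCone_nonneg hφ hq hx)
    (by
      rintro ⟨μ, s⟩
      obtain ⟨t, ht⟩ := exists_mem_formCone (j := j) (φ := φ) (q := q) μ
      refine ⟨⟨(0, t - s), ⟨t - s, rfl⟩⟩, ?_⟩
      simpa using ht)
  let Λ : ((X ⊗[ℂ] K) × (X ⊗[ℂ] K) →₀ ℂ) →ₗ[ℝ] ℝ := -(g ∘ₗ LinearMap.inl ℝ _ ℝ)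
  have hΛ : ∀ μ t, (μ, t) ∈ C → Λ μ ≤ t := by
    intro μ t h
    have h1 := hgC _ h
    have h2 : g (0, t) = t := hg0 ⟨(0, t), ⟨t, rfl⟩⟩
    have h3 : g (μ, t) = g (μ, 0) + g (0, t) := by rw [← map_add]; simp
    simp only [Λ, LinearMap.neg_apply, LinearMap.comp_apply, LinearMap.inl_apply]
    linarith
  have hemp : PB j (Empty.elim : Empty → X ⊗[ℂ] K) 0 :=
    ⟨Empty, inferInstance, 0, 0, matContr_zero, by simp, by simp⟩
  have hle : ∀ μ, (∀ f, (evForm f μ).re = 0) → Λ μ ≤ 0 := fun μ h =>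
    hΛ _ _ ⟨Empty, Empty, inferInstance, inferInstance, Empty.elim, Empty.elim, 0, 0, hemp,
      lb_zero _, by simp, by simp [h]⟩
  have heq : ∀ μ ν, (∀ f, (evForm f μ).re = (evForm f ν).re) → Λ μ = Λ ν := by
    intro μ ν h
    have h1 := hle (μ - ν) fun f => by simp [h]
    have h2 := hle (ν - μ) fun f => by simp [h]
    rw [map_sub] at h1 h2
    linarith
  have hlow : ∀ (κ : Type) [Fintype κ] (y : κ → X ⊗[ℂ] K) (r : ℝ), LB j φ q y r →
        r ≤ ∑ k, Λ (Finsupp.single (y k, y k) 1) := by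
    intro κ _ y r h
    have := hΛ (-∑ k, Finsupp.single (y k, y k) 1) (-r)
      ⟨Empty, κ, inferInstance, inferInstance, Empty.elim, y, 0, r, hemp, h, by simp, fun f => by
        simp [map_neg, map_sum, evForm_single_self]⟩
    rw [map_neg, map_sum] at this
    linarith
  have hreal : ∀ (x y : X ⊗[ℂ] K) (c : ℂ), Λ (Finsupp.single (x, y) c) =
      c.re * Λ (Finsupp.single (x, y) 1) + c.im * Λ (Finsupp.single (x, y) Complex.I) := by
    intro x y c
    rw [← smul_eq_mul, ← smul_eq_mul, ← map_smul, ← map_smul, ← map_add, Finsupp.smul_single,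
      Finsupp.smul_single, ← Finsupp.single_add]
    congr 2
    apply Complex.ext <;> simp
  let q' : PreInnerProductSpace.Core ℂ (X ⊗[ℂ] K) :=
    { inner := fun x y => Λ (Finsupp.single (x, y) 1) -
        Complex.I * Λ (Finsupp.single (x, y) Complex.I)
      conj_inner_symm := by
        intro x y
        have h1 : Λ (Finsupp.single (y, x) 1) = Λ (Finsupp.single (x, y) 1) :=
          heq _ _ fun f => by simp only [evForm_single]; simp; ring
        have h2 : Λ (Finsupp.single (y, x) Complex.I) = -Λ (Finsupp.single (x, y) Complex.I) := by
          rw [← map_neg]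
          exact heq _ _ fun f => by simp only [map_neg, evForm_single]; simp; ring
        simp [h1, h2, sub_eq_add_neg]
      re_inner_nonneg := by
        intro x
        have := hlow Unit (fun _ => x) 0 (lb_zero _)
        simpa using this
      add_left := by
        intro x y z
        have h : ∀ c, Λ (Finsupp.single (x + y, z) c) =
            Λ (Finsupp.single (x, z) c) + Λ (Finsupp.single (y, z) c) := fun c => by
          rw [← map_add]
          exact heq _ _ fun f => by simp only [map_add, evForm_single]; simp; ring
        simp only [h]
        push_cast
        ring
      smul_left := by
        intro x y r
        have h : ∀ c, Λ (Finsupp.single (r • x, y) c) = Λ (Finsupp.single (x, y) (conj r * c)) :=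
          fun c => heq _ _ fun f => by
            simp only [evForm_single, map_smul, smul_eq_mul, map_mul]
            congr 1
            ring
        simp only [h]
        rw [hreal x y (conj r * 1), hreal x y (conj r * Complex.I)]
        apply Complex.ext
        · simp
          ring
        · simp }
  have hq' : ∀ x, (q'.inner x x).re = Λ (Finsupp.single (x, x) 1) := fun x => by
    change ((Λ (Finsupp.single (x, x) 1) : ℂ) -
        Complex.I * Λ (Finsupp.single (x, x) Complex.I)).re = _
    simp
  refine ⟨q', ?_, ?_⟩
  · intro ι _ w t h
    simp_rw [hq']
    rw [← map_sum]
    exact hΛ _ _ ⟨ι, Empty, inferInstance, inferInstance, w, Empty.elim, t, 0, h, lb_zero _,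
      by simp, fun f => by simp [map_sum, evForm_single_self]⟩
  · intro κ _ y r h
    simp_rw [hq']
    exact hlow κ y r h

end Sandwich

section Maximal

variable {X : Type*} [AddCommGroup X] [Module ℂ X]
variable {H : Type*} [NormedAddCommGroup H] [InnerProductSpace ℂ H]
variable {K : Type*} [NormedAddCommGroup K] [InnerProductSpace ℂ K]
variable {j : X →ₗ[ℂ] H →L[ℂ] H}

/-- The pointwise order of positive semidefinite forms, on the diagonal. -/
def FormLE {F : Type*} [AddCommGroup F] [Module ℂ F] (p q : PreInnerProductSpace.Core ℂ F) : Prop :=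
  ∀ x, (p.inner x x).re ≤ (q.inner x x).re

lemma norm_core_inner_le {F : Type*} [AddCommGroup F] [Module ℂ F]
    (q : PreInnerProductSpace.Core ℂ F) (x y : F) :
    ‖q.inner x y‖ ≤ (q.inner x x).re + (q.inner y y).re := by
  have h1 : ‖q.inner x y‖ * ‖q.inner y x‖ ≤ (q.inner x x).re * (q.inner y y).re :=
    InnerProductSpace.Core.inner_mul_inner_self_le (c := q) x y
  have h2 : ‖q.inner y x‖ = ‖q.inner x y‖ := by
    rw [← q.conj_inner_symm x y]
    exact (Complex.norm_conj _).symm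
  rw [h2] at h1
  have hx : 0 ≤ (q.inner x x).re := q.re_inner_nonneg x
  have hy : 0 ≤ (q.inner y y).re := q.re_inner_nonneg y
  refine le_of_sq_le_sq ?_ (add_nonneg hx hy)
  nlinarith [sq_nonneg ((q.inner x x).re - (q.inner y y).re)]

lemma exists_admissible_limit {α : Type*} (U : Ultrafilter α)
    (q : α → PreInnerProductSpace.Core ℂ (X ⊗[ℂ] K)) (hq : ∀ a, Admissible j (q a)) :
    ∃ p : PreInnerProductSpace.Core ℂ (X ⊗[ℂ] K), Admissible j p ∧
      ∀ x y, Tendsto (fun a => (q a).inner x y) U (𝓝 (p.inner x y)) := by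
  have hlim : ∀ x y, ∃ l : ℂ, Tendsto (fun a => (q a).inner x y) U (𝓝 l) := by
    intro x y
    obtain ⟨s, hs⟩ := exists_pb (j := j) x
    obtain ⟨t, ht⟩ := exists_pb (j := j) y
    have hb : ∀ a, (q a).inner x y ∈ Metric.closedBall (0 : ℂ) (s + t) := by
      intro a
      rw [mem_closedBall_zero_iff]
      have h1 := hq a _ _ _ hs
      have h2 := hq a _ _ _ ht
      simp only [Finset.univ_unique, Finset.sum_singleton] at h1 h2
      linarith [norm_core_inner_le (q a) x y]
    obtain ⟨l, -, hl⟩ := (isCompact_closedBall (0 : ℂ) (s + t)).ultrafilter_le_nhds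
      (U.map fun a => (q a).inner x y)
      (tendsto_principal.2 (Eventually.of_forall hb))
    exact ⟨l, hl⟩
  choose l hl using hlim
  have hre : ∀ x, Tendsto (fun a => ((q a).inner x x).re) U (𝓝 (l x x).re) := fun x =>
    (Complex.continuous_re.tendsto _).comp (hl x x)
  refine ⟨{ inner := l
            conj_inner_symm := fun x y => ?_
            re_inner_nonneg := fun x => ?_
            add_left := fun x y z => ?_
            smul_left := fun x y r => ?_ }, ?_, hl⟩
  · refine tendsto_nhds_unique ((Complex.continuous_conj.tendsto _).comp (hl y x)) ?_
    exact (hl x y).congr fun a => ((q a).conj_inner_symm x y).symm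
  · exact ge_of_tendsto' (hre x) fun a => (q a).re_inner_nonneg x
  · refine tendsto_nhds_unique (hl (x + y) z) ?_
    exact ((hl x z).add (hl y z)).congr fun a => ((q a).add_left x y z).symm
  · refine tendsto_nhds_unique (hl (r • x) y) ?_
    exact ((hl x y).const_mul _).congr fun a => ((q a).smul_left x y r).symm
  · intro ι _ w t h
    exact le_of_tendsto' (tendsto_finsetSum _ fun i _ => hre (w i)) fun a => hq a _ _ _ h

lemma exists_maximal_admissible {q₀ : PreInnerProductSpace.Core ℂ (X ⊗[ℂ] K)}
    (h₀ : Admissible j q₀) :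
    ∃ q : PreInnerProductSpace.Core ℂ (X ⊗[ℂ] K), Admissible j q ∧ FormLE q₀ q ∧
      ∀ p, Admissible j p → FormLE q p → FormLE p q := by
  let A := {q : PreInnerProductSpace.Core ℂ (X ⊗[ℂ] K) // Admissible j q ∧ FormLE q₀ q}
  have : Nonempty A := ⟨⟨q₀, h₀, fun _ => le_rfl⟩⟩
  have trans : ∀ {p q r : PreInnerProductSpace.Core ℂ (X ⊗[ℂ] K)},
    FormLE p q → FormLE q r → FormLE p r := fun h h' x => (h x).trans (h' x)
  obtain ⟨m, hm⟩ := exists_maximal_of_nonempty_chains_bounded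
    (r := fun p q : A => FormLE p.1 q.1) (by
      intro c hc hne
      let _ : Preorder c :=
        { le := fun p q => FormLE p.1.1 q.1.1
          le_refl := fun p x => le_rfl
          le_trans := fun p q r h h' => trans h h' }
      have : Nonempty c := hne.to_subtype
      have : IsDirected c (· ≤ ·) := ⟨fun p q => by
        by_cases hpq : p.1 = q.1
        · exact ⟨q, fun x => by rw [hpq], fun x => le_rfl⟩
        · rcases hc p.2 q.2 hpq with h | h
          · exact ⟨q, h, fun x => le_rfl⟩
          · exact ⟨p, fun x => le_rfl, h⟩⟩
      obtain ⟨p, hp, hlim⟩ := exists_admissible_limit (Ultrafilter.of (atTop : Filter c))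
        (fun a => a.1.1) (fun a => a.1.2.1)
      have hub : ∀ a : c, FormLE a.1.1 p := by
        intro a x
        refine ge_of_tendsto ((Complex.continuous_re.tendsto _).comp (hlim x x)) ?_
        refine Ultrafilter.of_le (atTop : Filter c) ?_
        filter_upwards [eventually_ge_atTop a] with b hb using hb x
      obtain ⟨a⟩ := hne.to_subtype
      exact ⟨⟨p, hp, trans a.1.2.2 (hub a)⟩, fun b hb => hub ⟨b, hb⟩⟩) trans
  refine ⟨m.1, m.2.1, m.2.2, fun p hp hle => hm ⟨p, hp, trans m.2.2 hle⟩ hle⟩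

end Maximal

lemma eq_adjoint_of_norm_le {V W : Type*} [NormedAddCommGroup V] [InnerProductSpace ℂ V]
    [CompleteSpace V] [NormedAddCommGroup W] [InnerProductSpace ℂ W] [CompleteSpace W]
    {P : V →L[ℂ] W} (hP : ‖P‖ ≤ 1) {x : V} (hx : ‖x‖ ≤ ‖P x‖) :
    x = ContinuousLinearMap.adjoint P (P x) := by
  have h1 : ‖ContinuousLinearMap.adjoint P (P x)‖ ≤ ‖P x‖ := by
    have := ContinuousLinearMap.le_of_opNorm_le (ContinuousLinearMap.adjoint P) (c := 1)
      (by simpa using hP) (P x)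
    simpa using this
  have h2 := @norm_sub_sq ℂ V _ _ _ x (ContinuousLinearMap.adjoint P (P x))
  rw [ContinuousLinearMap.adjoint_inner_right, inner_self_eq_norm_sq] at h2
  have h3 := pow_le_pow_left₀ (norm_nonneg _) h1 2
  have h4 := pow_le_pow_left₀ (norm_nonneg _) hx 2
  have h5 : ‖x - ContinuousLinearMap.adjoint P (P x)‖ ^ 2 ≤ 0 := by linarith
  have h6 : ‖x - ContinuousLinearMap.adjoint P (P x)‖ = 0 :=
    pow_eq_zero_iff two_ne_zero |>.1 (le_antisymm h5 (sq_nonneg _))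
  exact sub_eq_zero.1 (norm_eq_zero.1 h6)

section Dilation

variable {X : Type*} [AddCommGroup X] [Module ℂ X]
variable {H : Type*} [NormedAddCommGroup H] [InnerProductSpace ℂ H]
variable {K L : Type*} [NormedAddCommGroup K] [InnerProductSpace ℂ K]
  [NormedAddCommGroup L] [InnerProductSpace ℂ L]
variable {j : X →ₗ[ℂ] H →L[ℂ] H} {φ : X →ₗ[ℂ] X →ₗ[ℂ] X}

/-- The linear map on `X ⊗ K` induced by an operator valued map on `X`. -/
noncomputable def tensorLift (D : X →ₗ[ℂ] K →L[ℂ] L) : X ⊗[ℂ] K →ₗ[ℂ] L :=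
  TensorProduct.lift (ContinuousLinearMap.coeLM ℂ ∘ₗ D)

@[simp] lemma tensorLift_tmul (D : X →ₗ[ℂ] K →L[ℂ] L) (a : X) (u : K) :
    tensorLift D (a ⊗ₜ u) = D a u := rfl

/-- The positive semidefinite form obtained by pulling back the inner product. -/
@[reducible]
noncomputable def pullbackForm {F : Type*} [AddCommGroup F] [Module ℂ F] (ψ : F →ₗ[ℂ] L) :
    PreInnerProductSpace.Core ℂ F where
  inner x y := inner ℂ (ψ x) (ψ y)
  conj_inner_symm x y := inner_conj_symm _ _
  re_inner_nonneg x := inner_self_nonneg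
  add_left x y z := by simp
  smul_left x y r := by rw [map_smul, inner_smul_left]

lemma pullbackForm_re {F : Type*} [AddCommGroup F] [Module ℂ F] (ψ : F →ₗ[ℂ] L) (x : F) :
    ((pullbackForm ψ).inner x x).re = ‖ψ x‖ ^ 2 :=
  inner_self_eq_norm_sq (𝕜 := ℂ) (ψ x)

lemma admissible_pullbackForm {D : X →ₗ[ℂ] K →L[ℂ] L} (hD : CompContr j D) :
    Admissible j (pullbackForm (tensorLift D)) := by
  rintro ι _ w t ⟨κ, _, a, u, ha, hw, hu⟩
  simp_rw [pullbackForm_re, hw, map_sum, tensorLift_tmul]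
  exact (hD _ _ _ ha u).trans hu

lemma pb_tmul {x : X} {r : ℝ} (hr : 0 < r) (hx : ‖j x‖ ≤ r) (u : K) :
    PB j (fun _ : Unit => x ⊗ₜ[ℂ] u) (r ^ 2 * ‖u‖ ^ 2) := by
  have hc : (r : ℂ) ≠ 0 := Complex.ofReal_ne_zero.2 hr.ne'
  refine ⟨Unit, inferInstance, Matrix.of fun _ _ => (r : ℂ)⁻¹ • x, fun _ => (r : ℂ) • u,
    ?_, ?_, ?_⟩
  · rw [matContr_unit_iff, map_smul, norm_smul, norm_inv, Complex.norm_of_nonneg hr.le]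
    exact (inv_mul_le_one₀ hr).2 hx
  · intro _
    simp only [Matrix.of_apply, Finset.univ_unique, Finset.sum_singleton]
    rw [TensorProduct.smul_tmul, smul_smul, inv_mul_cancel₀ hc, one_smul]
  · simp [norm_smul, mul_pow]

lemma Admissible.tmul_le {q : PreInnerProductSpace.Core ℂ (X ⊗[ℂ] K)} (hq : Admissible j q)
    (x : X) (u : K) : (q.inner (x ⊗ₜ u) (x ⊗ₜ u)).re ≤ (‖j x‖ * ‖u‖) ^ 2 := by
  have h : ∀ ε > 0, (q.inner (x ⊗ₜ u) (x ⊗ₜ u)).re ≤ ((‖j x‖ + ε) * ‖u‖) ^ 2 := by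
    intro ε hε
    have := hq _ _ _ (pb_tmul (j := j) (x := x) (r := ‖j x‖ + ε) (by positivity) (by linarith) u)
    rw [mul_pow]
    simpa using this
  have hc : Tendsto (fun ε : ℝ => ((‖j x‖ + ε) * ‖u‖) ^ 2) (𝓝[>] 0)
      (𝓝 (((‖j x‖ + 0) * ‖u‖) ^ 2)) :=
    ((Continuous.tendsto (by fun_prop) 0)).mono_left nhdsWithin_le_nhds
  rw [add_zero] at hc
  exact ge_of_tendsto hc (by filter_upwards [self_mem_nhdsWithin] with ε hε using h ε hε)

/-- A maximal admissible form is contractive for the action of contractive matrices. -/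
lemma matAct_le_of_maximal {q : PreInnerProductSpace.Core ℂ (X ⊗[ℂ] K)} (hφ : MulContr j φ)
    (hq : Admissible j q) (hmax : ∀ p, Admissible j p → FormLE q p → FormLE p q)
    {α : Type*} {l : Filter α} [l.NeBot] {f : α → X} (hf1 : ∀ a, ‖j (f a)‖ ≤ 1)
    (hf : ∀ x, Tendsto (fun a => j (φ (f a) x)) l (𝓝 (j x)))
    {ι κ : Type} [Fintype ι] [Fintype κ] {b : Matrix ι κ X} (hb : MatContr j b)
    (y : κ → X ⊗[ℂ] K) :
    ∑ i, (q.inner (matAct φ b y i) (matAct φ b y i)).re ≤ ∑ k, (q.inner (y k) (y k)).re := by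
  obtain ⟨q', hq', hle⟩ := exists_admissible_ge hφ hq
  suffices h : FormLE q q' from
    (hle κ y _ ⟨ι, inferInstance, b, hb, le_rfl⟩).trans
      (Finset.sum_le_sum fun k _ => hmax q' hq' h (y k))
  intro v
  let _ : SeminormedAddCommGroup (X ⊗[ℂ] K) :=
    InnerProductSpace.Core.toSeminormedAddCommGroup (c := q)
  have hnorm : ∀ x : X ⊗[ℂ] K, (q.inner x x).re = ‖x‖ ^ 2 := fun x => by
    change _ = Real.sqrt _ ^ 2
    rw [Real.sq_sqrt (q.re_inner_nonneg x)]
    rfl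
  have hlim : ∀ v : X ⊗[ℂ] K, Tendsto (fun a => (φ (f a)).rTensor K v) l (𝓝 v) := by
    intro v
    induction v using TensorProduct.induction_on with
    | zero => simpa using tendsto_const_nhds
    | add x y hx hy => simpa using hx.add hy
    | tmul x u =>
      rw [tendsto_iff_norm_sub_tendsto_zero]
      have h0 := ((tendsto_iff_norm_sub_tendsto_zero.1 (hf x)).mul_const ‖u‖)
      rw [zero_mul] at h0
      refine squeeze_zero (fun _ => norm_nonneg _) (fun a => ?_) h0
      rw [LinearMap.rTensor_tmul, ← TensorProduct.sub_tmul, ← map_sub]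
      refine le_of_sq_le_sq ?_ (by positivity)
      rw [← hnorm]
      exact hq.tmul_le _ _
  have h1 : Tendsto (fun a => (q.inner ((φ (f a)).rTensor K v) ((φ (f a)).rTensor K v)).re) l
      (𝓝 (q.inner v v).re) := by
    simp_rw [hnorm]
    exact ((hlim v).norm).pow 2
  refine le_of_tendsto' h1 fun a => ?_
  have := hle Unit (fun _ => v) _ ⟨Unit, inferInstance, Matrix.of fun _ _ => f a,
    matContr_unit_iff.2 (hf1 a), le_rfl⟩
  simpa [matAct] using this

end Dilation

lemma exists_hilbert_of_form {F : Type u} [AddCommGroup F] [Module ℂ F]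
    (q : PreInnerProductSpace.Core ℂ F) :
    ∃ (V : Type u) (_ : NormedAddCommGroup V) (_ : InnerProductSpace ℂ V) (_ : CompleteSpace V)
      (ρ : F →ₗ[ℂ] V), DenseRange ρ ∧ ∀ x, ‖ρ x‖ ^ 2 = (q.inner x x).re := by
  let _ : SeminormedAddCommGroup F := InnerProductSpace.Core.toSeminormedAddCommGroup (c := q)
  let _ : InnerProductSpace ℂ F := InnerProductSpace.ofCore q
  refine ⟨UniformSpace.Completion F, inferInstance, inferInstance, inferInstance,
    (UniformSpace.Completion.toComplL (𝕜 := ℂ) (E := F)).toLinearMap,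
    UniformSpace.Completion.denseRange_coe, fun x => ?_⟩
  change ‖(x : UniformSpace.Completion F)‖ ^ 2 = _
  rw [UniformSpace.Completion.norm_coe, ← @inner_self_eq_norm_sq ℂ F]
  rfl

section Step

variable {X H K L : Type u} [AddCommGroup X] [Module ℂ X]
variable [NormedAddCommGroup H] [InnerProductSpace ℂ H]
variable [NormedAddCommGroup K] [InnerProductSpace ℂ K]
  [NormedAddCommGroup L] [InnerProductSpace ℂ L] [CompleteSpace L]
variable {j : X →ₗ[ℂ] H →L[ℂ] H} {φ : X →ₗ[ℂ] X →ₗ[ℂ] X}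

/-- A completely contractive map `S₀` factors as `P ∘ D` in a maximal way, and left
multiplication acts on the dilation space in a completely contractive way. -/
theorem exists_maximal_dilation (hφ : MulContr j φ) {S₀ : X →ₗ[ℂ] K →L[ℂ] L}
    (hS₀ : CompContr j S₀) {α : Type*} {l : Filter α} [l.NeBot] {f : α → X}
    (hf1 : ∀ a, ‖j (f a)‖ ≤ 1) (hf : ∀ x, Tendsto (fun a => j (φ (f a) x)) l (𝓝 (j x))) :
    ∃ (V : Type u) (_ : NormedAddCommGroup V) (_ : InnerProductSpace ℂ V) (_ : CompleteSpace V)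
      (D : X →ₗ[ℂ] K →L[ℂ] V) (P : V →L[ℂ] L) (S : X →ₗ[ℂ] V →L[ℂ] V),
      CompContr j D ∧ CompContr j S ∧ ‖P‖ ≤ 1 ∧ (∀ a u, P (D a u) = S₀ a u) ∧
      (∀ b a u, S b (D a u) = D (φ b a) u) ∧ DenseRange (tensorLift D) ∧
      ∀ (W : Type u) [NormedAddCommGroup W] [InnerProductSpace ℂ W] [CompleteSpace W]
        (D' : X →ₗ[ℂ] K →L[ℂ] W) (P' : W →L[ℂ] V), CompContr j D' → ‖P'‖ ≤ 1 →
        (∀ a u, P' (D' a u) = D a u) →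
        ∀ a u, D' a u = ContinuousLinearMap.adjoint P' (D a u) := by
  obtain ⟨q, hq, hq₀, hmax⟩ := exists_maximal_admissible (admissible_pullbackForm hS₀)
  obtain ⟨V, _, _, _, ρ, hρ, hρq⟩ := exists_hilbert_of_form q
  have hact := fun {ι κ : Type} [Fintype ι] [Fintype κ] {b : Matrix ι κ X} (hb : MatContr j b) y =>
    matAct_le_of_maximal hφ hq hmax hf1 hf hb y
  simp_rw [← hρq] at hact
  have hP : ∀ x, ‖tensorLift S₀ x‖ ≤ 1 * ‖ρ x‖ := by
    intro x
    refine le_of_sq_le_sq ?_ (by positivity)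
    rw [one_mul, hρq, ← pullbackForm_re]
    exact hq₀ x
  have hD : ∀ a u, ‖ρ (a ⊗ₜ u)‖ ≤ ‖j a‖ * ‖u‖ := fun a u =>
    le_of_sq_le_sq ((hρq _).le.trans (hq.tmul_le a u)) (by positivity)
  let D : X →ₗ[ℂ] K →L[ℂ] V :=
    { toFun := fun a => (ρ ∘ₗ TensorProduct.mk ℂ X K a).mkContinuous ‖j a‖ (hD a)
      map_add' := fun a b => by
        ext u
        change ρ ((a + b) ⊗ₜ u) = ρ (a ⊗ₜ u) + ρ (b ⊗ₜ u)
        rw [TensorProduct.add_tmul, map_add]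
      map_smul' := fun c a => by
        ext u
        change ρ ((c • a) ⊗ₜ u) = c • ρ (a ⊗ₜ u)
        rw [← TensorProduct.smul_tmul', map_smul] }
  have hDρ : ∀ a u, D a u = ρ (a ⊗ₜ u) := fun a u => rfl
  have hlift : tensorLift D = ρ := by ext a u; rfl
  have hDcc : CompContr j D := by
    intro ι κ _ _ a ha u
    have := hq ι (fun i => ∑ k, a i k ⊗ₜ u k) _ ⟨κ, inferInstance, a, u, ha, fun i => rfl, le_rfl⟩
    simp_rw [← hρq, map_sum] at this
    exact this
  have hS : ∀ b x, ‖ρ ((φ b).rTensor K x)‖ ≤ (‖j b‖ + 1) * ‖ρ x‖ := by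
    intro b x
    have hr : 0 < ‖j b‖ + 1 := by positivity
    have h1 : MatContr j (Matrix.of fun (_ _ : Unit) => ((‖j b‖ + 1 : ℝ) : ℂ)⁻¹ • b) := by
      rw [matContr_unit_iff, map_smul, norm_smul, norm_inv, Complex.norm_of_nonneg hr.le]
      exact (inv_mul_le_one₀ hr).2 (by linarith)
    have h2 := hact h1 fun _ => x
    simp only [matAct, Finset.univ_unique, Finset.sum_singleton, Matrix.of_apply, map_smul,
      LinearMap.rTensor_smul, LinearMap.smul_apply, norm_smul, norm_inv,
      Complex.norm_of_nonneg hr.le] at h2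
    have h3 := le_of_sq_le_sq h2 (norm_nonneg _)
    rwa [inv_mul_le_iff₀ hr] at h3
  let T : X → V →L[ℂ] V := fun b => (ρ ∘ₗ (φ b).rTensor K).extendOfNorm ρ
  have hT : ∀ b x, T b (ρ x) = ρ ((φ b).rTensor K x) := fun b x =>
    LinearMap.extendOfNorm_eq hρ ⟨_, hS b⟩ x
  have hext : ∀ A B : V →L[ℂ] V, (∀ x, A (ρ x) = B (ρ x)) → A = B := fun A B h =>
    DFunLike.coe_injective (hρ.equalizer A.continuous B.continuous (funext h))
  let S : X →ₗ[ℂ] V →L[ℂ] V :=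
    { toFun := T
      map_add' := fun a b => hext _ _ fun x => by simp [hT, LinearMap.rTensor_add]
      map_smul' := fun c a => hext _ _ fun x => by simp [hT, LinearMap.rTensor_smul] }
  have hSρ : ∀ b x, S b (ρ x) = ρ ((φ b).rTensor K x) := hT
  have hScc : CompContr j S := by
    intro ι κ _ _ b hb u
    have hd : DenseRange (Pi.map fun (_ : κ) => (ρ : X ⊗[ℂ] K → V)) := DenseRange.piMap fun _ => hρ
    refine hd.induction_on (p := fun u : κ → V =>
      ∑ i, ‖∑ k, S (b i k) (u k)‖ ^ 2 ≤ ∑ k, ‖u k‖ ^ 2) u ?_ fun y => ?_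
    · exact isClosed_le (by fun_prop) (by fun_prop)
    · have := hact hb y
      simpa [matAct, hSρ] using this
  refine ⟨V, inferInstance, inferInstance, inferInstance, D, (tensorLift S₀).extendOfNorm ρ, S,
    hDcc, hScc, ?_, ?_, ?_, ?_, ?_⟩
  · exact ContinuousLinearMap.opNorm_le_bound _ zero_le_one
      (LinearMap.norm_extendOfNorm_apply_le hρ 1 hP)
  · exact fun a u => LinearMap.extendOfNorm_eq hρ ⟨1, hP⟩ (a ⊗ₜ u)
  · exact fun b a u => hSρ b (a ⊗ₜ u)
  · rwa [hlift]
  · intro W _ _ _ D' P' hD' hP' hPD a u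
    have h1 : ∀ x, P' (tensorLift D' x) = ρ x := by
      intro x
      have : P'.toLinearMap ∘ₗ tensorLift D' = ρ := by
        ext a u
        exact hPD a u
      exact LinearMap.congr_fun this x
    have h2 : FormLE q (pullbackForm (tensorLift D')) := by
      intro x
      rw [pullbackForm_re, ← hρq, ← h1]
      refine pow_le_pow_left₀ (norm_nonneg _) ?_ 2
      simpa using P'.le_of_opNorm_le hP' (tensorLift D' x)
    have h3 := hmax _ (admissible_pullbackForm hD') h2 (a ⊗ₜ u)
    rw [pullbackForm_re, ← hρq, ← h1] at h3
    rw [← hPD]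
    exact eq_adjoint_of_norm_le hP' (le_of_sq_le_sq h3 (norm_nonneg _))

end Step

section WeakLimit

variable {K L : Type*} [NormedAddCommGroup K] [InnerProductSpace ℂ K]
  [NormedAddCommGroup L] [InnerProductSpace ℂ L] [CompleteSpace L]

/-- Contractions are compact in the weak operator topology. -/
lemma exists_weak_limit {α : Type*} (U : Ultrafilter α) (T : α → K →L[ℂ] L)
    (hT : ∀ a, ‖T a‖ ≤ 1) :
    ∃ E : K →L[ℂ] L, ‖E‖ ≤ 1 ∧
      ∀ u v, Tendsto (fun a => inner ℂ (T a u) v) U (𝓝 (inner ℂ (E u) v)) := by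
  have hTu : ∀ a u, ‖T a u‖ ≤ ‖u‖ := fun a u => by
    simpa using (T a).le_of_opNorm_le (hT a) u
  have hbound : ∀ a u v, ‖inner ℂ (T a u) v‖ ≤ ‖u‖ * ‖v‖ := fun a u v =>
    (norm_inner_le_norm _ _).trans (mul_le_mul_of_nonneg_right (hTu a u) (norm_nonneg v))
  have hlim : ∀ u v, ∃ l : ℂ, Tendsto (fun a => inner ℂ (T a u) v) U (𝓝 l) := by
    intro u v
    obtain ⟨l, -, hl⟩ := (isCompact_closedBall (0 : ℂ) (‖u‖ * ‖v‖)).ultrafilter_le_nhds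
      (U.map fun a => inner ℂ (T a u) v)
      (tendsto_principal.2 (Eventually.of_forall fun a => by
        rw [mem_closedBall_zero_iff]; exact hbound a u v))
    exact ⟨l, hl⟩
  choose l hl using hlim
  have hlb : ∀ u v, ‖l u v‖ ≤ ‖u‖ * ‖v‖ := fun u v =>
    le_of_tendsto' (hl u v).norm fun a => hbound a u v
  have hrep : ∀ u, ∃ w : L, ∀ v, inner ℂ w v = l u v := by
    intro u
    let g : L →ₗ[ℂ] ℂ :=
      { toFun := l u
        map_add' := fun v w => tendsto_nhds_unique (hl u (v + w))
          (((hl u v).add (hl u w)).congr fun a => (inner_add_right _ _ _).symm)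
        map_smul' := fun c v => tendsto_nhds_unique (hl u (c • v))
          (((hl u v).const_mul c).congr fun a => (inner_smul_right _ _ _).symm) }
    refine ⟨(InnerProductSpace.toDual ℂ L).symm (g.mkContinuous ‖u‖ (hlb u)), fun v => ?_⟩
    rw [InnerProductSpace.toDual_symm_apply]
    rfl
  choose E hE using hrep
  simp_rw [← hE] at hl hlb
  let E' : K →ₗ[ℂ] L :=
    { toFun := E
      map_add' := fun u w => ext_inner_right ℂ fun v => by
        refine tendsto_nhds_unique (hl (u + w) v) ?_
        rw [inner_add_left]
        exact ((hl u v).add (hl w v)).congr fun a => by rw [map_add, inner_add_left]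
      map_smul' := fun c u => ext_inner_right ℂ fun v => by
        refine tendsto_nhds_unique (hl (c • u) v) ?_
        rw [inner_smul_left]
        exact ((hl u v).const_mul _).congr fun a => by
          rw [map_smul, inner_smul_left, RingHom.id_apply] }
  have hE' : ∀ u, ‖E' u‖ ≤ 1 * ‖u‖ := by
    intro u
    have h := hlb u (E u)
    rw [inner_self_eq_norm_sq_to_K] at h
    have h2 : ‖E u‖ * ‖E u‖ ≤ ‖u‖ * ‖E u‖ := by simpa [sq] using h
    rw [one_mul]
    change ‖E u‖ ≤ ‖u‖
    by_contra! hlt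
    nlinarith [norm_nonneg u]
  exact ⟨E'.mkContinuous 1 hE', E'.mkContinuous_norm_le zero_le_one hE', hl⟩

end WeakLimit

section Associativity

variable {X H K L V : Type*} [AddCommGroup X] [Module ℂ X]
variable [NormedAddCommGroup H] [InnerProductSpace ℂ H]
variable [NormedAddCommGroup K] [InnerProductSpace ℂ K]
  [NormedAddCommGroup L] [InnerProductSpace ℂ L]
  [NormedAddCommGroup V] [InnerProductSpace ℂ V]
variable {j : X →ₗ[ℂ] H →L[ℂ] H} {φ : X →ₗ[ℂ] X →ₗ[ℂ] X}

lemma CompContr.tendsto {D : X →ₗ[ℂ] K →L[ℂ] L} (hD : CompContr j D) {α : Type*} {l : Filter α}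
    {g : α → X} {x : X} (hg : Tendsto (fun a => j (g a)) l (𝓝 (j x))) (u : K) :
    Tendsto (fun a => D (g a) u) l (𝓝 (D x u)) := by
  have h : Tendsto (fun a => D (g a)) l (𝓝 (D x)) := by
    rw [tendsto_iff_norm_sub_tendsto_zero] at hg ⊢
    refine squeeze_zero (fun _ => norm_nonneg _) (fun a => ?_) hg
    rw [← map_sub, ← map_sub]
    exact hD.norm_le _
  exact ((ContinuousLinearMap.apply ℂ L u).continuous.tendsto _).comp h

/-- Left multiplication by a left approximate identity tends strongly to the identity. -/
lemma tendsto_leftMul {D : X →ₗ[ℂ] K →L[ℂ] V} {S : X →ₗ[ℂ] V →L[ℂ] V} (hD : CompContr j D)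
    (hS : CompContr j S) (hSD : ∀ b a u, S b (D a u) = D (φ b a) u)
    (hdense : DenseRange (tensorLift D)) {α : Type*} {l : Filter α} {f : α → X}
    (hf1 : ∀ a, ‖j (f a)‖ ≤ 1) (hf : ∀ x, Tendsto (fun a => j (φ (f a) x)) l (𝓝 (j x)))
    (v : V) : Tendsto (fun a => S (f a) v) l (𝓝 v) := by
  have hrange : ∀ x, Tendsto (fun a => S (f a) (tensorLift D x)) l (𝓝 (tensorLift D x)) := by
    intro x
    induction x with
    | zero => simpa using tendsto_const_nhds
    | add x y hx hy => simpa using hx.add hy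
    | tmul a u => simpa [hSD] using hD.tendsto (hf a) u
  have hSv : ∀ a w, ‖S (f a) w‖ ≤ ‖w‖ := fun a w => by
    simpa using (S (f a)).le_of_opNorm_le ((hS.norm_le _).trans (hf1 a)) w
  rw [Metric.tendsto_nhds]
  intro ε hε
  obtain ⟨x, hx⟩ := hdense.exists_dist_lt v (show 0 < ε / 3 by positivity)
  filter_upwards [Metric.tendsto_nhds.1 (hrange x) (ε / 3) (by positivity)] with a ha
  have h1 : dist (S (f a) v) (S (f a) (tensorLift D x)) ≤ dist v (tensorLift D x) := by
    rw [dist_eq_norm, dist_eq_norm, ← map_sub]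
    exact hSv a _
  have h2 := dist_triangle4 (S (f a) v) (S (f a) (tensorLift D x)) (tensorLift D x) v
  rw [dist_comm (tensorLift D x) v] at h2
  linarith

/-- If a contraction sends contractive images `y a` of `u` to a family tending to `u`, then
`y a` tends to the image of `u` under the adjoint. -/
lemma tendsto_adjoint [CompleteSpace L] [CompleteSpace V] {P : V →L[ℂ] L} (hP : ‖P‖ ≤ 1)
    {α : Type*} {l : Filter α} {y : α → V} {u : L} (hy : ∀ a, ‖y a‖ ≤ ‖u‖)
    (h : Tendsto (fun a => P (y a)) l (𝓝 u)) :
    Tendsto y l (𝓝 (ContinuousLinearMap.adjoint P u)) := by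
  have hV : ‖ContinuousLinearMap.adjoint P u‖ ≤ ‖u‖ := by
    simpa using (ContinuousLinearMap.adjoint P).le_of_opNorm_le
      ((LinearIsometryEquiv.norm_map ContinuousLinearMap.adjoint P).trans_le hP) u
  rw [tendsto_iff_norm_sub_tendsto_zero]
  have hsq : Tendsto (fun a => ‖y a - ContinuousLinearMap.adjoint P u‖ ^ 2) l (𝓝 0) := by
    have hin : Tendsto (fun a => 2 * ‖u‖ ^ 2 - 2 * RCLike.re (inner ℂ (P (y a)) u)) l (𝓝 0) := by
      have h1 : Tendsto (fun a => inner ℂ (P (y a)) u) l (𝓝 (inner ℂ u u)) :=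
        h.inner tendsto_const_nhds
      have h2 := (((RCLike.continuous_re (K := ℂ)).tendsto _).comp h1).const_mul 2
      have h3 := h2.const_sub (2 * ‖u‖ ^ 2)
      rwa [inner_self_eq_norm_sq (𝕜 := ℂ) u, sub_self] at h3
    refine squeeze_zero (fun _ => sq_nonneg _) (fun a => ?_) hin
    rw [@norm_sub_sq ℂ, ContinuousLinearMap.adjoint_inner_right]
    have h1 := pow_le_pow_left₀ (norm_nonneg _) (hy a) 2
    have h2 := pow_le_pow_left₀ (norm_nonneg _) hV 2
    linarith
  simpa using hsq.sqrt

/-- If `E` is a weak limit of `D (e a)` along a right approximate identity, then left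
multiplication by `b` sends `E` to `D b`. -/
lemma leftMul_weak_limit [CompleteSpace V] {D : X →ₗ[ℂ] K →L[ℂ] V} {S : X →ₗ[ℂ] V →L[ℂ] V}
    (hD : CompContr j D) (hSD : ∀ b a u, S b (D a u) = D (φ b a) u)
    {α : Type*} {l : Filter α} [l.NeBot] {e : α → X}
    (he : ∀ x, Tendsto (fun a => j (φ x (e a))) l (𝓝 (j x))) {E : K →L[ℂ] V}
    (hE : ∀ u v, Tendsto (fun a => inner ℂ (D (e a) u) v) l (𝓝 (inner ℂ (E u) v))) (b : X)
    (u : K) : S b (E u) = D b u := by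
  refine ext_inner_right ℂ fun v => ?_
  have h1 := hE u (ContinuousLinearMap.adjoint (S b) v)
  simp_rw [ContinuousLinearMap.adjoint_inner_right, hSD] at h1
  exact tendsto_nhds_unique h1 ((hD.tendsto (he b) u).inner tendsto_const_nhds)

end Associativity

/-- A completely contractive bilinear map with a contractive left and a contractive right
approximate identity is associative. -/
theorem assoc_of_approximate_identities {X H : Type u} [AddCommGroup X] [Module ℂ X]
    [NormedAddCommGroup H] [InnerProductSpace ℂ H] [CompleteSpace H]
    {j : X →ₗ[ℂ] H →L[ℂ] H} (hj : Function.Injective j) {φ : X →ₗ[ℂ] X →ₗ[ℂ] X}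
    (hφ : MulContr j φ) {α β : Type*} {l : Filter α} [l.NeBot] {m : Filter β} [m.NeBot]
    {e : α → X} {f : β → X} (he1 : ∀ a, ‖j (e a)‖ ≤ 1) (hf1 : ∀ a, ‖j (f a)‖ ≤ 1)
    (he : ∀ x, Tendsto (fun a => j (φ x (e a))) l (𝓝 (j x)))
    (hf : ∀ x, Tendsto (fun a => j (φ (f a) x)) m (𝓝 (j x))) (x y w : X) :
    φ (φ x y) w = φ x (φ y w) := by
  have hjj : CompContr j j := fun _ _ _ _ _ ha => ha
  obtain ⟨K₁, _, _, _, D₀, P₀, S₁, hD₀, hS₁, -, hPD₀, hSD₀, hdense₀, hmax₀⟩ :=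
    exists_maximal_dilation hφ hjj hf1 hf
  obtain ⟨K₂, _, _, _, D₁, P₁, S₂, hD₁, hS₂, hP₁, hPD₁, hSD₁, hdense₁, -⟩ :=
    exists_maximal_dilation hφ hS₁ hf1 hf
  have hS₁f := tendsto_leftMul hD₀ hS₁ hSD₀ hdense₀ hf1 hf
  have hS₂f := tendsto_leftMul hD₁ hS₂ hSD₁ hdense₁ hf1 hf
  let V := ContinuousLinearMap.adjoint P₁
  have hD₁f : ∀ u, Tendsto (fun b => D₁ (f b) u) m (𝓝 (V u)) := by
    intro u
    refine tendsto_adjoint hP₁ (fun b => ?_) ?_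
    · simpa using (D₁ (f b)).le_of_opNorm_le ((hD₁.norm_le _).trans (hf1 b)) u
    · simpa [hPD₁] using hS₁f u
  have hPV : ∀ u, P₁ (V u) = u := by
    intro u
    refine tendsto_nhds_unique ((P₁.continuous.tendsto _).comp (hD₁f u)) ?_
    simpa [Function.comp_def, hPD₁] using hS₁f u
  have he' : ∀ x, Tendsto (fun a => j (φ x (e a))) (Ultrafilter.of l) (𝓝 (j x)) := fun x =>
    (he x).mono_left (Ultrafilter.of_le l)
  obtain ⟨E₀, hE₀, hlim₀⟩ := exists_weak_limit (Ultrafilter.of l) (fun a => D₀ (e a))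
    fun a => hD₀.norm_le _ |>.trans (he1 a)
  obtain ⟨E₁, -, hlim₁⟩ := exists_weak_limit (Ultrafilter.of l) (fun a => D₁ (e a))
    fun a => hD₁.norm_le _ |>.trans (he1 a)
  have hSE₀ := leftMul_weak_limit hD₀ hSD₀ he' hlim₀
  have hSE₁ := leftMul_weak_limit hD₁ hSD₁ he' hlim₁
  have hE₁V : ∀ u, E₁ u = V u := fun u =>
    tendsto_nhds_unique ((hS₂f (E₁ u)).congr fun b => hSE₁ _ u) (hD₁f u)
  have hSV : ∀ b u, S₂ b (V u) = D₁ b u := fun b u => by rw [← hE₁V, hSE₁]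
  have hDE : ∀ a u, D₁ a (E₀ u) = V (D₀ a u) := by
    let D' : X →ₗ[ℂ] H →L[ℂ] K₂ :=
      { toFun := fun a => (D₁ a).comp E₀
        map_add' := fun a b => by ext; simp
        map_smul' := fun c a => by ext; simp }
    refine hmax₀ K₂ D' P₁ ?_ hP₁ fun a u => ?_
    · intro ι κ _ _ a ha u
      refine (hD₁ ι κ a ha fun k => E₀ (u k)).trans (Finset.sum_le_sum fun k _ => ?_)
      refine pow_le_pow_left₀ (norm_nonneg _) ?_ 2
      simpa using E₀.le_of_opNorm_le hE₀ (u k)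
    · exact (hPD₁ a (E₀ u)).trans (hSE₀ a u)
  have hDD : ∀ b a u, D₁ b (D₀ a u) = V (D₀ (φ b a) u) := fun b a u => by
    rw [← hSV, ← hDE, hSD₁, hDE]
  refine hj (ContinuousLinearMap.ext fun u => ?_)
  have h : V (D₀ (φ (φ x y) w) u) = V (D₀ (φ x (φ y w)) u) := by
    rw [← hDD, ← hSD₁, hDD, hSV, hDD]
  rw [← hPD₀, ← hPD₀, ← hPV (D₀ (φ (φ x y) w) u), h, hPV]

end ChristensenSinclair

/-- Let `X` be a nonzero closed subspace of `B(H)` and `φ : X × X → X` a bilinear map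
which is completely contractive in the Christensen–Sinclair sense.  If there are nets
`(e_α)`, `(f_β)` in the unit ball of `X` with `φ(x, e_α) → x` and `φ(f_β, x) → x` in
norm for every `x ∈ X`, then `φ` is associative. -/
theorem stmt4 {H : Type*} [NormedAddCommGroup H] [InnerProductSpace ℂ H]
    [CompleteSpace H]
    (X : Submodule ℂ (H →L[ℂ] H)) (hXc : IsClosed (X : Set (H →L[ℂ] H))) (hX0 : X ≠ ⊥)
    (φ : X →ₗ[ℂ] X →ₗ[ℂ] X)
    (hφcc : ∀ (n : ℕ) (a b : Matrix (Fin n) (Fin n) X),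
      cstarMatrixNorm (Matrix.of fun i j => ((∑ k, φ (a i k) (b k j) : X) : H →L[ℂ] H)) ≤
        cstarMatrixNorm (a.map (fun x => (x : H →L[ℂ] H))) *
          cstarMatrixNorm (b.map (fun x => (x : H →L[ℂ] H))))
    {ι κ : Type*} [Preorder ι] [IsDirected ι (· ≤ ·)] [Nonempty ι]
    [Preorder κ] [IsDirected κ (· ≤ ·)] [Nonempty κ]
    (e : ι → X) (f : κ → X)
    (he1 : ∀ α, ‖(e α : H →L[ℂ] H)‖ ≤ 1) (hf1 : ∀ β, ‖(f β : H →L[ℂ] H)‖ ≤ 1)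
    (he : ∀ x : X, Filter.Tendsto (fun α => ((φ x (e α) : X) : H →L[ℂ] H))
      Filter.atTop (nhds (x : H →L[ℂ] H)))
    (hf : ∀ x : X, Filter.Tendsto (fun β => ((φ (f β) x : X) : H →L[ℂ] H))
      Filter.atTop (nhds (x : H →L[ℂ] H))) :
    ∀ x y w : X, φ (φ x y) w = φ x (φ y w) := by
  exact ChristensenSinclair.assoc_of_approximate_identities
    (j := X.subtype) Subtype.val_injective
    (fun _ _ _ _ _ _ _ _ ha hb => ChristensenSinclair.MatContr.bilinMul hφcc ha hb)
    he1 hf1 he hf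
end
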